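/- Let w be an Oleinik solution on [0,X]. For any 0 < ε < X and any integer k ≥ 2 there exist δ > 0 and a constant C > 0, independent of ψ, such that for all (x,ψ) ∈ [ε,X]×(0,δ]: |∂ₓ^k w(x,ψ)| ≤ C ψ, |∂_ψ ∂ₓ^k w(x,ψ)| ≤ C, and |∂_ψ² ∂ₓ^k w(x,ψ)| ≤ C ψ^{−1}. -/

import Mathlib

open Set

/-- Iterated partial derivative `∂ₓ^k ∂_ψ^m w` of a function of two real variables. -/
noncomputable def pd (k m : ℕ) (w : ℝ → ℝ → ℝ) (x ψ : ℝ) : ℝ :=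
  iteratedDeriv k (fun x' => iteratedDeriv m (w x') ψ) x

/-- Von Mises formulation of the steady Prandtl equation with favorable pressure:
`w` is an Oleinik solution on `[0,X]` with structural constants `α, m, M, C₀, δ₁`. -/
structure OleinikSolution (X : ℝ) (p : ℝ → ℝ) (w : ℝ → ℝ → ℝ)
    (α m M C₀ δ₁ : ℝ) : Prop where
  hX : 0 < X
  hp : ContDiff ℝ (⊤ : ℕ∞) p
  hfav : ∀ x : ℝ, deriv p x ≤ 0
  hα : α ∈ Set.Ioo (0 : ℝ) (1 / 2)
  hm : 0 < m
  hmM : m < M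
  hC₀ : 0 < C₀
  hδ₁ : δ₁ ∈ Set.Ioo (0 : ℝ) 1
  cont : ContinuousOn (fun z : ℝ × ℝ => w z.1 z.2) (Set.Icc 0 X ×ˢ Set.Ici 0)
  smooth : ContDiffOn ℝ (⊤ : ℕ∞) (fun z : ℝ × ℝ => w z.1 z.2) (Set.Ioc 0 X ×ˢ Set.Ioi 0)
  bdry : ∀ x ∈ Set.Icc (0 : ℝ) X, w x 0 = 0
  eqn : ∀ x ∈ Set.Ioc (0 : ℝ) X, ∀ ψ ∈ Set.Ioi (0 : ℝ),
    pd 1 0 w x ψ - Real.sqrt (w x ψ) * pd 0 2 w x ψ = -2 * deriv p x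
  slope_lb : ∀ x ∈ Set.Icc (0 : ℝ) X, ∀ ψ ∈ Set.Icc (0 : ℝ) δ₁, m < pd 0 1 w x ψ
  slope_ub : ∀ x ∈ Set.Icc (0 : ℝ) X, ∀ ψ ∈ Set.Icc (0 : ℝ) δ₁, pd 0 1 w x ψ < M
  growth_lb : ∀ x ∈ Set.Icc (0 : ℝ) X, ∀ ψ ∈ Set.Ioc (0 : ℝ) δ₁, m * ψ < w x ψ
  growth_ub : ∀ x ∈ Set.Icc (0 : ℝ) X, ∀ ψ ∈ Set.Ioc (0 : ℝ) δ₁, w x ψ < M * ψ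
  dx_bound : ∀ x ∈ Set.Icc (0 : ℝ) X, ∀ ψ ∈ Set.Icc (0 : ℝ) δ₁,
    |pd 1 0 w x ψ| ≤ C₀ * ψ ^ ((1 : ℝ) / 2 + α)


noncomputable def Dx (F : ℝ → ℝ → ℝ) : ℝ → ℝ → ℝ := fun x y => deriv (fun s => F s y) x
noncomputable def Dy (F : ℝ → ℝ → ℝ) : ℝ → ℝ → ℝ := fun x y => deriv (fun t => F x t) y
noncomputable def WW (w : ℝ → ℝ → ℝ) (k : ℕ) : ℝ → ℝ → ℝ :=
  fun x y => iteratedDeriv k (fun s => w s y) x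

lemma Dx_WW (w : ℝ → ℝ → ℝ) (k : ℕ) : Dx (WW w k) = WW w (k+1) := by
  funext x y
  simp only [Dx, WW, iteratedDeriv_succ]

lemma WW_zero (w : ℝ → ℝ → ℝ) : WW w 0 = w := by
  funext x y
  simp [WW]

def Sm (U : Set (ℝ × ℝ)) (F : ℝ → ℝ → ℝ) : Prop :=
  ContDiffOn ℝ (⊤ : ℕ∞) (fun z : ℝ × ℝ => F z.1 z.2) U

lemma Sm.diffAt {U : Set (ℝ × ℝ)} (hU : IsOpen U) {F : ℝ → ℝ → ℝ} (hF : Sm U F) {x y : ℝ}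
    (h : (x, y) ∈ U) : DifferentiableAt ℝ (fun z : ℝ × ℝ => F z.1 z.2) (x, y) :=
  (hF.contDiffAt (hU.mem_nhds h)).differentiableAt (by simp)

lemma Sm.hasDx' {U : Set (ℝ × ℝ)} (hU : IsOpen U) {F : ℝ → ℝ → ℝ} (hF : Sm U F) {x y : ℝ}
    (h : (x, y) ∈ U) : HasDerivAt (fun s => F s y)
      (fderiv ℝ (fun z : ℝ × ℝ => F z.1 z.2) (x, y) (1, 0)) x := by
  have h1 := (hF.diffAt hU h).hasFDerivAt
  have h2 : HasDerivAt (fun s : ℝ => (s, y)) ((1 : ℝ), (0 : ℝ)) x :=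
    (hasDerivAt_id x).prodMk (hasDerivAt_const x y)
  exact h1.comp_hasDerivAt x h2

lemma Sm.hasDy' {U : Set (ℝ × ℝ)} (hU : IsOpen U) {F : ℝ → ℝ → ℝ} (hF : Sm U F) {x y : ℝ}
    (h : (x, y) ∈ U) : HasDerivAt (fun t => F x t)
      (fderiv ℝ (fun z : ℝ × ℝ => F z.1 z.2) (x, y) (0, 1)) y := by
  have h1 := (hF.diffAt hU h).hasFDerivAt
  have h2 : HasDerivAt (fun s : ℝ => (x, s)) ((0 : ℝ), (1 : ℝ)) y :=
    (hasDerivAt_const y x).prodMk (hasDerivAt_id y)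
  exact h1.comp_hasDerivAt y h2

lemma Sm.hasDx {U : Set (ℝ × ℝ)} (hU : IsOpen U) {F : ℝ → ℝ → ℝ} (hF : Sm U F) {x y : ℝ}
    (h : (x, y) ∈ U) : HasDerivAt (fun s => F s y) (Dx F x y) x :=
  (hF.hasDx' hU h).differentiableAt.hasDerivAt

lemma Sm.hasDy {U : Set (ℝ × ℝ)} (hU : IsOpen U) {F : ℝ → ℝ → ℝ} (hF : Sm U F) {x y : ℝ}
    (h : (x, y) ∈ U) : HasDerivAt (fun t => F x t) (Dy F x y) y :=
  (hF.hasDy' hU h).differentiableAt.hasDerivAt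

lemma Sm.Dx_eq {U : Set (ℝ × ℝ)} (hU : IsOpen U) {F : ℝ → ℝ → ℝ} (hF : Sm U F) {x y : ℝ}
    (h : (x, y) ∈ U) : Dx F x y = fderiv ℝ (fun z : ℝ × ℝ => F z.1 z.2) (x, y) (1, 0) :=
  (hF.hasDx' hU h).deriv

lemma Sm.Dy_eq {U : Set (ℝ × ℝ)} (hU : IsOpen U) {F : ℝ → ℝ → ℝ} (hF : Sm U F) {x y : ℝ}
    (h : (x, y) ∈ U) : Dy F x y = fderiv ℝ (fun z : ℝ × ℝ => F z.1 z.2) (x, y) (0, 1) :=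
  (hF.hasDy' hU h).deriv

lemma Sm.fd {U : Set (ℝ × ℝ)} (hU : IsOpen U) {F : ℝ → ℝ → ℝ} (hF : Sm U F) :
    ContDiffOn ℝ (⊤ : ℕ∞) (fderiv ℝ (fun z : ℝ × ℝ => F z.1 z.2)) U :=
  hF.fderiv_of_isOpen hU (by simp)

lemma Sm.dx {U : Set (ℝ × ℝ)} (hU : IsOpen U) {F : ℝ → ℝ → ℝ} (hF : Sm U F) : Sm U (Dx F) := by
  have := (hF.fd hU).clm_apply (contDiffOn_const (c := ((1 : ℝ), (0 : ℝ))))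
  exact this.congr (fun z hz => hF.Dx_eq hU hz)

lemma Sm.dy {U : Set (ℝ × ℝ)} (hU : IsOpen U) {F : ℝ → ℝ → ℝ} (hF : Sm U F) : Sm U (Dy F) := by
  have := (hF.fd hU).clm_apply (contDiffOn_const (c := ((0 : ℝ), (1 : ℝ))))
  exact this.congr (fun z hz => hF.Dy_eq hU hz)

lemma Dx_congr {U : Set (ℝ × ℝ)} (hU : IsOpen U) {F G : ℝ → ℝ → ℝ}
    (h : ∀ x y, (x, y) ∈ U → F x y = G x y) {x y : ℝ} (hz : (x, y) ∈ U) :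
    Dx F x y = Dx G x y := by
  apply Filter.EventuallyEq.deriv_eq
  have : ∀ᶠ s in nhds x, (s, y) ∈ U :=
    (Continuous.continuousAt (by fun_prop : Continuous fun s : ℝ => (s, y))).eventually
      (hU.mem_nhds hz)
  filter_upwards [this] with s hs using h s y hs

lemma Dy_congr {U : Set (ℝ × ℝ)} (hU : IsOpen U) {F G : ℝ → ℝ → ℝ}
    (h : ∀ x y, (x, y) ∈ U → F x y = G x y) {x y : ℝ} (hz : (x, y) ∈ U) :
    Dy F x y = Dy G x y := by
  apply Filter.EventuallyEq.deriv_eq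
  have : ∀ᶠ s in nhds y, (x, s) ∈ U :=
    (Continuous.continuousAt (by fun_prop : Continuous fun s : ℝ => (x, s))).eventually
      (hU.mem_nhds hz)
  filter_upwards [this] with s hs using h x s hs

lemma Sm.comm {U : Set (ℝ × ℝ)} (hU : IsOpen U) {F : ℝ → ℝ → ℝ} (hF : Sm U F) {x y : ℝ}
    (h : (x, y) ∈ U) : Dx (Dy F) x y = Dy (Dx F) x y := by
  rw [(hF.dy hU).Dx_eq hU h, (hF.dx hU).Dy_eq hU h]
  have hd : DifferentiableAt ℝ (fderiv ℝ (fun z : ℝ × ℝ => F z.1 z.2)) (x, y) :=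
    ((hF.fd hU).contDiffAt (hU.mem_nhds h)).differentiableAt (by simp)
  have e1 : (fun z : ℝ × ℝ => Dy F z.1 z.2) =ᶠ[nhds (x, y)]
      (fun z => fderiv ℝ (fun z : ℝ × ℝ => F z.1 z.2) z (0, 1)) := by
    filter_upwards [hU.mem_nhds h] with z hz using hF.Dy_eq hU hz
  have e2 : (fun z : ℝ × ℝ => Dx F z.1 z.2) =ᶠ[nhds (x, y)]
      (fun z => fderiv ℝ (fun z : ℝ × ℝ => F z.1 z.2) z (1, 0)) := by
    filter_upwards [hU.mem_nhds h] with z hz using hF.Dx_eq hU hz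
  rw [e1.fderiv_eq, e2.fderiv_eq]
  rw [fderiv_clm_apply hd (by fun_prop), fderiv_clm_apply hd (by fun_prop)]
  have hs : IsSymmSndFDerivAt ℝ (fun z : ℝ × ℝ => F z.1 z.2) (x, y) := by
    apply (hF.contDiffAt (hU.mem_nhds h)).isSymmSndFDerivAt
    simp only [minSmoothness_of_isRCLikeNormedField]
    exact WithTop.coe_le_coe.mpr (le_top (a := (2 : ℕ∞)))
  have := hs.eq (1, 0) (0, 1)
  simpa using this

lemma Sm.WW {U : Set (ℝ × ℝ)} (hU : IsOpen U) {F : ℝ → ℝ → ℝ} (hF : Sm U F) (k : ℕ) :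
    Sm U (WW F k) := by
  induction k with
  | zero => rwa [WW_zero]
  | succ k ih => rw [← Dx_WW]; exact ih.dx hU

lemma WW_Dy {U : Set (ℝ × ℝ)} (hU : IsOpen U) {F : ℝ → ℝ → ℝ} (hF : Sm U F) (k : ℕ) :
    ∀ x y, (x, y) ∈ U → _root_.WW (Dy F) k x y = Dy (_root_.WW F k) x y := by
  induction k with
  | zero => intro x y h; simp only [WW_zero]
  | succ k ih =>
    intro x y h
    rw [← Dx_WW, ← Dx_WW, Dx_congr hU ih h, (hF.WW hU k).comm hU h]

lemma WW_congr {U : Set (ℝ × ℝ)} (hU : IsOpen U) {F G : ℝ → ℝ → ℝ}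
    (h : ∀ x y, (x, y) ∈ U → F x y = G x y) (k : ℕ) :
    ∀ x y, (x, y) ∈ U → WW F k x y = WW G k x y := by
  induction k with
  | zero => simpa only [WW_zero] using h
  | succ k ih =>
    intro x y hz
    rw [← Dx_WW, ← Dx_WW, Dx_congr hU ih hz]

lemma Sm.contOn {U : Set (ℝ × ℝ)} {F : ℝ → ℝ → ℝ} (hF : Sm U F) :
    ContinuousOn (fun z : ℝ × ℝ => F z.1 z.2) U := ContDiffOn.continuousOn hF

/-- necessary conditions at a maximum over a rectangle -/
lemma at_max {x1 x2 y1 y2 : ℝ} {Z : ℝ → ℝ → ℝ} {Zx Zyy : ℝ} {Zy : ℝ → ℝ} {x0 y0 : ℝ}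
    (hx : x0 ∈ Ioc x1 x2) (hy : y0 ∈ Ioo y1 y2)
    (hmax : ∀ x ∈ Icc x1 x2, ∀ y ∈ Icc y1 y2, Z x y ≤ Z x0 y0)
    (h1 : HasDerivAt (fun s => Z s y0) Zx x0)
    (h2 : ∀ y ∈ Ioo y1 y2, HasDerivAt (fun t => Z x0 t) (Zy y) y)
    (h3 : HasDerivAt Zy Zyy y0) : 0 ≤ Zx ∧ Zyy ≤ 0 := by
  constructor
  · by_contra hneg
    push Not at hneg
    have h4 := h1.tendsto_slope
    have h5 : ∀ᶠ s in nhdsWithin x0 {x0}ᶜ, slope (fun s => Z s y0) x0 s < 0 :=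
      h4.eventually (gt_mem_nhds hneg)
    have h6 : ∀ᶠ s in nhdsWithin x0 (Iio x0), slope (fun s => Z s y0) x0 s < 0 :=
      h5.filter_mono (nhdsWithin_mono _ (fun s hs => ne_of_lt hs))
    have h7 : ∀ᶠ s in nhdsWithin x0 (Iio x0), s ∈ Ioo x1 x0 := Ioo_mem_nhdsLT hx.1
    obtain ⟨s, hs1, hs2⟩ := (h6.and h7).exists
    have := hmax s ⟨hs2.1.le, hs2.2.le.trans hx.2⟩ y0 ⟨hy.1.le, hy.2.le⟩
    rw [slope_def_field] at hs1
    have h8 : 0 ≤ (Z s y0 - Z x0 y0) / (s - x0) :=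
      div_nonneg_of_nonpos (by linarith) (by linarith [hs2.2])
    linarith
  · by_contra hpos
    push Not at hpos
    have hx' : x0 ∈ Icc x1 x2 := ⟨hx.1.le, hx.2⟩
    have hloc : IsLocalMax (fun t => Z x0 t) y0 := by
      filter_upwards [Ioo_mem_nhds hy.1 hy.2] with t ht
      exact hmax x0 hx' t ⟨ht.1.le, ht.2.le⟩
    have hz : Zy y0 = 0 := hloc.hasDerivAt_eq_zero (h2 y0 hy)
    have he : deriv (fun t => Z x0 t) =ᶠ[nhds y0] Zy := by
      filter_upwards [Ioo_mem_nhds hy.1 hy.2] with t ht using (h2 t ht).deriv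
    have hmin : IsLocalMin (fun t => Z x0 t) y0 := by
      apply isLocalMin_of_deriv_deriv_pos
      · rw [he.deriv_eq, h3.deriv]; exact hpos
      · rw [he.eq_of_nhds, hz]
      · exact (h2 y0 hy).continuousAt
    have hc : (fun t => Z x0 t) =ᶠ[nhds y0] fun _ => Z x0 y0 := by
      filter_upwards [hloc, hmin] with t a b using le_antisymm a b
    have hd : deriv (fun t => Z x0 t) =ᶠ[nhds y0] fun _ => 0 := by
      have := hc.deriv
      simpa using this
    have : Zyy = 0 := by
      rw [← h3.deriv, (he.symm.trans hd).deriv_eq]; simp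
    linarith

/-- comparison with a multiple of a barrier -/
lemma ratio_max {x1 x2 y1 y2 K : ℝ} (hy12 : y1 ≤ y2)
    {G Gx Gy Gyy a : ℝ → ℝ → ℝ} {b b1 b2 : ℝ → ℝ}
    (hc : ContinuousOn (fun z : ℝ × ℝ => G z.1 z.2) (Icc x1 x2 ×ˢ Icc y1 y2))
    (hbc : ContinuousOn b (Icc y1 y2))
    (hbpos : ∀ y ∈ Icc y1 y2, 0 < b y)
    (hGx : ∀ x ∈ Ioc x1 x2, ∀ y ∈ Ioo y1 y2, HasDerivAt (fun s => G s y) (Gx x y) x)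
    (hGy : ∀ x ∈ Ioc x1 x2, ∀ y ∈ Ioo y1 y2, HasDerivAt (fun t => G x t) (Gy x y) y)
    (hGyy : ∀ x ∈ Ioc x1 x2, ∀ y ∈ Ioo y1 y2, HasDerivAt (fun t => Gy x t) (Gyy x y) y)
    (hb1 : ∀ y ∈ Ioo y1 y2, HasDerivAt b (b1 y) y)
    (hb2 : ∀ y ∈ Ioo y1 y2, HasDerivAt b1 (b2 y) y)
    (ha : ∀ x ∈ Ioc x1 x2, ∀ y ∈ Ioo y1 y2, 0 ≤ a x y)
    (hbd1 : ∀ y ∈ Icc y1 y2, |G x1 y| ≤ K * b y)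
    (hbd2 : ∀ x ∈ Icc x1 x2, |G x y1| ≤ K * b y1)
    (hbd3 : ∀ x ∈ Icc x1 x2, |G x y2| ≤ K * b y2)
    (hP : ∀ x ∈ Ioc x1 x2, ∀ y ∈ Ioo y1 y2, ∀ L, K < L → |G x y| = L * b y →
      |Gx x y - a x y * Gyy x y| < - (L * (a x y * b2 y))) :
    ∀ x ∈ Icc x1 x2, ∀ y ∈ Icc y1 y2, |G x y| ≤ K * b y := by
  by_contra hcon
  push Not at hcon
  obtain ⟨xa, hxa, ya, hya, hlt⟩ := hcon
  have hcomp : IsCompact (Icc x1 x2 ×ˢ Icc y1 y2) := isCompact_Icc.prod isCompact_Icc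
  have hcq : ContinuousOn (fun z : ℝ × ℝ => |G z.1 z.2| / b z.2) (Icc x1 x2 ×ˢ Icc y1 y2) := by
    apply ContinuousOn.div hc.abs
    · exact hbc.comp continuous_snd.continuousOn (fun z hz => hz.2)
    · intro z hz; exact (hbpos _ hz.2).ne'
  obtain ⟨⟨x0, y0⟩, hz0, hm⟩ := hcomp.exists_isMaxOn ⟨(xa, ya), hxa, hya⟩ hcq
  have hx0 : x0 ∈ Icc x1 x2 := hz0.1
  have hy0 : y0 ∈ Icc y1 y2 := hz0.2
  set L := |G x0 y0| / b y0 with hL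
  have hmL : ∀ x ∈ Icc x1 x2, ∀ y ∈ Icc y1 y2, |G x y| ≤ L * b y := by
    intro x hx y hy
    have : |G x y| / b y ≤ L := hm (show (x, y) ∈ _ from ⟨hx, hy⟩)
    rwa [div_le_iff₀ (hbpos y hy)] at this
  have hKL : K < L := by
    have := hmL xa hxa ya hya
    have h := hbpos ya hya
    by_contra hh
    push Not at hh
    nlinarith
  have hGL : |G x0 y0| = L * b y0 := by
    rw [hL]; field_simp [(hbpos y0 hy0).ne']
  have hb0 := hbpos y0 hy0
  have hKb : K * b y0 < L * b y0 := by nlinarith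
  have hxi : x0 ∈ Ioc x1 x2 := by
    refine ⟨lt_of_le_of_ne hx0.1 ?_, hx0.2⟩
    rintro rfl
    have := hbd1 y0 hy0
    linarith
  have hyi : y0 ∈ Ioo y1 y2 := by
    refine ⟨lt_of_le_of_ne hy0.1 ?_, lt_of_le_of_ne hy0.2 ?_⟩
    · rintro rfl
      have := hbd2 x0 hx0
      linarith
    · rintro rfl
      have := hbd3 x0 hx0
      linarith
  have hPP := hP x0 hxi y0 hyi L hKL hGL
  have haa := ha x0 hxi y0 hyi
  have key : ∀ σ : ℝ, (σ = 1 ∨ σ = -1) → σ * G x0 y0 = |G x0 y0| → False := by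
    intro σ hσ hs
    have hle : ∀ t : ℝ, σ * t ≤ |t| := by
      intro t
      rcases hσ with rfl | rfl
      · simpa using le_abs_self t
      · simpa using neg_le_abs t
    obtain ⟨q1, q2⟩ := at_max (Z := fun x y => σ * G x y - L * b y)
      (Zx := σ * Gx x0 y0) (Zy := fun y => σ * Gy x0 y - L * b1 y)
      (Zyy := σ * Gyy x0 y0 - L * b2 y0) hxi hyi
      (by
        intro x hx y hy
        have := hmL x hx y hy
        have := hle (G x y)
        linarith)
      (by
        have := ((hGx x0 hxi y0 hyi).const_mul σ).sub_const (L * b y0)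
        exact this)
      (by
        intro y hy
        exact ((hGy x0 hxi y hy).const_mul σ).sub ((hb1 y hy).const_mul L))
      (((hGyy x0 hxi y0 hyi).const_mul σ).sub ((hb2 y0 hyi).const_mul L))
    have := hle (Gx x0 y0 - a x0 y0 * Gyy x0 y0)
    nlinarith [mul_nonneg haa (neg_nonneg.mpr q2)]
  rcases abs_choice (G x0 y0) with h | h
  · exact key 1 (Or.inl rfl) (by rw [h]; ring)
  · exact key (-1) (Or.inr rfl) (by rw [h]; ring)



lemma bern_u (C a t η η' u u1 Eu : ℝ) (hC : 1 ≤ C) (ha0 : 0 < a) (haC : a ≤ C)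
    (ht0 : 0 ≤ t) (ht1 : t ≤ 1) (hη0 : 0 ≤ η) (hη1 : η ≤ 1) (hη' : η' ^ 2 ≤ 4)
    (hEu : |Eu| ≤ C * (1 + |u|)) :
    2 * t * η ^ 4 * u ^ 2 + 2 * t ^ 2 * η ^ 4 * u * Eu
      - a * t ^ 2 * (12 * η ^ 2 * η' ^ 2 * u ^ 2 - 8 * η ^ 3 * u ^ 2 + 16 * η ^ 3 * η' * u * u1
        + 2 * η ^ 4 * u1 ^ 2) ≤ (2 + 200 * C) * (t * η ^ 2 * u ^ 2) + 2 * C := by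
  have hη2 : η ^ 2 ≤ 1 := by nlinarith
  have ht2 : t ^ 2 ≤ t := by nlinarith
  have e1 : t * η ^ 4 * u ^ 2 ≤ t * η ^ 2 * u ^ 2 := by
    have : t * η ^ 2 * u ^ 2 * (1 - η ^ 2) ≥ 0 := by
      apply mul_nonneg (by positivity) (by linarith)
    nlinarith
  have e2 : t ^ 2 * η ^ 2 * u ^ 2 ≤ t * η ^ 2 * u ^ 2 := by
    have : (t - t ^ 2) * (η ^ 2 * u ^ 2) ≥ 0 := mul_nonneg (by linarith) (by positivity)
    nlinarith
  have e3 : t ^ 2 * η ^ 4 * u ^ 2 ≤ t * η ^ 2 * u ^ 2 := by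
    have : t ^ 2 * η ^ 2 * u ^ 2 * (1 - η ^ 2) ≥ 0 := by
      apply mul_nonneg (by positivity) (by linarith)
    nlinarith
  have e4 : u * Eu ≤ C * (1 + 2 * u ^ 2) := by
    have h1 : u * Eu ≤ |u| * |Eu| := by rw [← abs_mul]; exact le_abs_self _
    have h2 : |u| * |Eu| ≤ |u| * (C * (1 + |u|)) :=
      mul_le_mul_of_nonneg_left hEu (abs_nonneg u)
    have h3 : |u| ^ 2 = u ^ 2 := sq_abs u
    nlinarith [sq_nonneg (|u| - 1)]
  have e5 : 2 * t ^ 2 * η ^ 4 * u * Eu ≤ 2 * C + 4 * C * (t * η ^ 2 * u ^ 2) := by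
    have h0 : 0 ≤ t ^ 2 * η ^ 4 := by positivity
    have h1 : t ^ 2 * η ^ 4 ≤ 1 := by
      have : t ^ 2 ≤ 1 := by linarith
      have : η ^ 4 ≤ 1 := by nlinarith
      exact mul_le_one₀ (by linarith) (by positivity) this
    have h2 := mul_le_mul_of_nonneg_left e4 h0
    nlinarith
  have e6 : - (a * t ^ 2 * (12 * η ^ 2 * η' ^ 2 * u ^ 2 - 8 * η ^ 3 * u ^ 2
      + 16 * η ^ 3 * η' * u * u1 + 2 * η ^ 4 * u1 ^ 2))
      ≤ a * (136 * (t ^ 2 * η ^ 2 * u ^ 2)) := by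
    have h1 : -(12 * η ^ 2 * η' ^ 2 * u ^ 2 - 8 * η ^ 3 * u ^ 2
      + 16 * η ^ 3 * η' * u * u1 + 2 * η ^ 4 * u1 ^ 2) ≤ 136 * (η ^ 2 * u ^ 2) := by
      have h2 : η ^ 3 * u ^ 2 ≤ η ^ 2 * u ^ 2 := by
        have : η ^ 2 * u ^ 2 * (1 - η) ≥ 0 := mul_nonneg (by positivity) (by linarith)
        nlinarith
      have h3 : η ^ 2 * u ^ 2 * (4 - η' ^ 2) ≥ 0 := mul_nonneg (by positivity) (by linarith)
      nlinarith [sq_nonneg (η ^ 2 * u1 + 4 * η * η' * u)]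
    have := mul_le_mul_of_nonneg_left h1 (show 0 ≤ a * t ^ 2 by positivity)
    nlinarith
  have e7 : a * (136 * (t ^ 2 * η ^ 2 * u ^ 2)) ≤ C * (136 * (t * η ^ 2 * u ^ 2)) := by
    apply mul_le_mul haC (by linarith) (by positivity) (by linarith)
  have : 0 ≤ C * (t * η ^ 2 * u ^ 2) := by positivity
  nlinarith

lemma bern_v (c C a t η η' v v1 Ev : ℝ) (hc : 0 < c) (hC : 1 ≤ C) (hca : c ≤ a) (haC : a ≤ C)
    (ht0 : 0 ≤ t) (ht1 : t ≤ 1) (hη0 : 0 ≤ η) (hη1 : η ≤ 1) (hη' : η' ^ 2 ≤ 4)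
    (hEv : |Ev| ≤ C * (1 + |v| + |v1|)) :
    η ^ 2 * v ^ 2 + 2 * t * η ^ 2 * v * Ev
      - a * t * (2 * η' ^ 2 * v ^ 2 - 4 * η * v ^ 2 + 8 * η * η' * v * v1 + 2 * η ^ 2 * v1 ^ 2)
      ≤ (1 + 100 * C + 2 * C ^ 2 / c) * v ^ 2 + C - c / 2 * (t * η ^ 2 * v1 ^ 2) := by
  have ha0 : 0 < a := by linarith
  have hη2 : η ^ 2 ≤ 1 := by nlinarith
  have hv2 : 0 ≤ v ^ 2 := sq_nonneg v
  have e4 : 2 * (v * Ev) ≤ C * (1 + 3 * v ^ 2) + c / 2 * v1 ^ 2 + 2 * C ^ 2 / c * v ^ 2 := by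
    have h1 : v * Ev ≤ |v| * |Ev| := by rw [← abs_mul]; exact le_abs_self _
    have h2 : |v| * |Ev| ≤ |v| * (C * (1 + |v| + |v1|)) :=
      mul_le_mul_of_nonneg_left hEv (abs_nonneg v)
    have h3 : |v| ^ 2 = v ^ 2 := sq_abs v
    have h3' : |v1| ^ 2 = v1 ^ 2 := sq_abs v1
    have h4 : 2 * C * |v| * |v1| ≤ c / 2 * v1 ^ 2 + 2 * C ^ 2 / c * v ^ 2 := by
      rw [← h3, ← h3']
      have : c / 2 * |v1| ^ 2 + 2 * C ^ 2 / c * |v| ^ 2 - 2 * C * |v| * |v1|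
        = (c * |v1| - 2 * C * |v|) ^ 2 / (2 * c) := by field_simp; ring
      have : 0 ≤ (c * |v1| - 2 * C * |v|) ^ 2 / (2 * c) := by positivity
      linarith
    nlinarith [sq_nonneg (|v| - 1)]
  have hs0 : 0 ≤ t * η ^ 2 := by positivity
  have hs1 : t * η ^ 2 ≤ 1 := mul_le_one₀ ht1 (by positivity) hη2
  have e5 : 2 * t * η ^ 2 * v * Ev ≤ C + 3 * C * v ^ 2 + 2 * C ^ 2 / c * v ^ 2
      + c / 2 * (t * η ^ 2 * v1 ^ 2) := by
    have h2 := mul_le_mul_of_nonneg_left e4 hs0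
    have h3 : 0 ≤ C + 3 * C * v ^ 2 + 2 * C ^ 2 / c * v ^ 2 := by positivity
    have h4 : t * η ^ 2 * (C + 3 * C * v ^ 2 + 2 * C ^ 2 / c * v ^ 2) ≤
      1 * (C + 3 * C * v ^ 2 + 2 * C ^ 2 / c * v ^ 2) := mul_le_mul_of_nonneg_right hs1 h3
    nlinarith
  have e6 : - (a * t * (2 * η' ^ 2 * v ^ 2 - 4 * η * v ^ 2 + 8 * η * η' * v * v1
      + 2 * η ^ 2 * v1 ^ 2)) ≤ a * t * (68 * v ^ 2 - η ^ 2 * v1 ^ 2) := by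
    have h1 : -(2 * η' ^ 2 * v ^ 2 - 4 * η * v ^ 2 + 8 * η * η' * v * v1
      + 2 * η ^ 2 * v1 ^ 2) ≤ 68 * v ^ 2 - η ^ 2 * v1 ^ 2 := by
      have h2 : η * v ^ 2 ≤ v ^ 2 := by nlinarith
      have h3 : v ^ 2 * (4 - η' ^ 2) ≥ 0 := mul_nonneg (by positivity) (by linarith)
      nlinarith [sq_nonneg (η * v1 + 4 * η' * v)]
    have := mul_le_mul_of_nonneg_left h1 (show 0 ≤ a * t by positivity)
    nlinarith
  have e7 : a * t * (68 * v ^ 2) ≤ C * (68 * v ^ 2) := by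
    apply mul_le_mul_of_nonneg_right _ (by positivity)
    nlinarith
  have e8 : c * (t * η ^ 2 * v1 ^ 2) ≤ a * (t * η ^ 2 * v1 ^ 2) :=
    mul_le_mul_of_nonneg_right hca (by positivity)
  have e9 : η ^ 2 * v ^ 2 ≤ v ^ 2 := by nlinarith
  have : 0 ≤ C * v ^ 2 := by positivity
  nlinarith

set_option maxHeartbeats 2000000 in
lemma bern_point (c C K1 K2 B1 B0 B : ℝ) (hc : 0 < c) (hC : 1 ≤ C)
    (hK1 : K1 = 2 + 200 * C) (hK2 : K2 = 1 + 100 * C + 2 * C ^ 2 / c)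
    (hB1 : B1 = 4 * C ^ 2 * K1 / c + 1) (hB0 : B0 = B1 * K2 / (2 * c))
    (hB : B = 2 * B0 * C ^ 2 + B1 * C + 2 * C + 2 * C ^ 2 * K1 + 1)
    (pK1 : 0 < K1) (pK2 : 0 < K2) (pB1 : 0 < B1) (pB0 : 0 < B0)
    (x0 e e' f' U Ux U1 U2 V Vx V1 V2 A : ℝ) {r : ℝ}
    (hx0 : x0 ∈ Icc (0:ℝ) 1) (hη0 : 0 ≤ e) (hη1 : e ≤ 1) (hη' : e' ^ 2 ≤ 4)
    (hca : c ≤ A) (haC : A ≤ C) (hf : |f'| ≤ C) (hR : |r| ≤ C) (hu : U = A * V1 + r)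
    (hEv : |Vx - A * V2| ≤ C * (1 + |V| + |V1|))
    (hEu : |Ux - A * U2| ≤ C * (1 + |U|))
    (q1 : 0 ≤ B0 * (2 * f' * U) + B1 * (e ^ 2 * V ^ 2
        + x0 * e ^ 2 * (2 * V * Vx)) + (2 * x0 * e ^ 4 * U ^ 2
        + x0 ^ 2 * e ^ 4 * (2 * U * Ux)) - B)
    (q2 : B0 * (2 * V * V + 2 * f' * V1)
        + B1 * ((x0 * (2 * e' * e' + 2 * e * (-2)) * V ^ 2
          + x0 * (2 * e * e') * (2 * V * V1))
          + (x0 * (2 * e * e') * (2 * V * V1)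
           + x0 * e ^ 2 * (2 * V1 * V1 + 2 * V * V2)))
        + ((x0 ^ 2 * (4 * (3 * e ^ 2 * e') * e' + 4 * e ^ 3 * (-2))
            * U ^ 2
            + x0 ^ 2 * (4 * e ^ 3 * e') * (2 * U * U1))
          + (x0 ^ 2 * (4 * e ^ 3 * e') * (2 * U * U1)
            + x0 ^ 2 * e ^ 4 * (2 * U1 * U1 + 2 * U * U2))) ≤ 0) : False := by
  have bu := bern_u C A x0 e e' U U1 _ hC (by linarith) haC
    hx0.1 hx0.2 hη0 hη1 hη' hEu
  have bv := bern_v c C A x0 e e' V V1 _ hc hC hca haC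
    hx0.1 hx0.2 hη0 hη1 hη' hEv
  rw [← hK1] at bu
  rw [← hK2] at bv
  have hA : 0 < A := by linarith
  have bv' := mul_le_mul_of_nonneg_left bv pB1.le
  have q3 := mul_nonneg hA.le (neg_nonneg.mpr q2)
  have hU2 : U ^ 2 ≤ 2 * C ^ 2 * V1 ^ 2 + 2 * C ^ 2 := by
    have h1 : r ^ 2 ≤ C ^ 2 := sq_le_sq' (abs_le.mp hR).1 (abs_le.mp hR).2
    have h2 : A ^ 2 ≤ C ^ 2 := pow_le_pow_left₀ hA.le haC 2
    have h3 : A ^ 2 * V1 ^ 2 ≤ C ^ 2 * V1 ^ 2 := mul_le_mul_of_nonneg_right h2 (sq_nonneg _)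
    rw [hu]
    have := sq_nonneg (A * V1 - r)
    clear q1 q2 q3 bu bv bv'
    linarith
  have hs0 : 0 ≤ x0 * e ^ 2 := mul_nonneg hx0.1 (sq_nonneg _)
  have hs1 : x0 * e ^ 2 ≤ 1 := mul_le_one₀ hx0.2 (by positivity) (pow_le_one₀ hη0 hη1)
  have hU3 : x0 * e ^ 2 * U ^ 2 ≤ 2 * C ^ 2 * (x0 * e ^ 2 * V1 ^ 2) + 2 * C ^ 2 := by
    have := mul_le_mul_of_nonneg_left hU2 hs0
    have : x0 * e ^ 2 * (2 * C ^ 2) ≤ 1 * (2 * C ^ 2) :=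
      mul_le_mul_of_nonneg_right hs1 (by positivity)
    clear q1 q2 q3 bu bv bv'
    linarith
  have hU4 := mul_le_mul_of_nonneg_left hU3 pK1.le
  have hfr : 2 * B0 * (f' * r) ≤ 2 * B0 * C ^ 2 := by
    apply mul_le_mul_of_nonneg_left _ (by positivity)
    have : f' * r ≤ |f'| * |r| := by rw [← abs_mul]; exact le_abs_self _
    have : |f'| * |r| ≤ C * C := mul_le_mul hf hR (abs_nonneg _) (by linarith)
    clear q1 q2 q3 bu bv bv'
    linarith
  have hb1 : B1 * (c / 2) = 2 * C ^ 2 * K1 + c / 2 := by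
    rw [hB1]; field_simp; ring
  have hb0 : 2 * c * B0 = B1 * K2 := by
    rw [hB0]; field_simp
  have hV : 2 * c * B0 * V ^ 2 ≤ 2 * A * B0 * V ^ 2 := by
    apply mul_le_mul_of_nonneg_right _ (sq_nonneg _)
    have := mul_le_mul_of_nonneg_right hca pB0.le
    linarith
  have hW : 0 ≤ c / 2 * (x0 * e ^ 2 * V1 ^ 2) := by positivity
  have hb1' : B1 * (c / 2) * (x0 * e ^ 2 * V1 ^ 2)
    = (2 * C ^ 2 * K1 + c / 2) * (x0 * e ^ 2 * V1 ^ 2) := by rw [hb1]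
  rw [hb0] at hV
  have hfu : B0 * (2 * f' * U) = 2 * B0 * (f' * r) + A * (B0 * (2 * f' * V1)) := by
    rw [hu]; ring
  rw [hfu] at q1
  have hBe : B = 2 * B0 * C ^ 2 + B1 * C + 2 * C + 2 * C ^ 2 * K1 + 1 := hB
  clear hB hB0 hB1 hK1 hK2 hEv hEu hu hca haC hf hR hη' hη0 hη1
  clear bv hU2 hU3 hs0 hs1 q2 hb0 hb1 hfu
  linarith

/-- Bernstein estimate at unit scale -/
lemma bernstein_unit (c C : ℝ) (hc : 0 < c) (hC : 1 ≤ C) : ∃ K : ℝ, 0 < K ∧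
    ∀ (f u ux u1 u2 v vx v1 v2 a R : ℝ → ℝ → ℝ),
    ContinuousOn (fun z : ℝ × ℝ => f z.1 z.2) (Icc 0 1 ×ˢ Icc 1 3) →
    ContinuousOn (fun z : ℝ × ℝ => u z.1 z.2) (Icc 0 1 ×ˢ Icc 1 3) →
    ContinuousOn (fun z : ℝ × ℝ => v z.1 z.2) (Icc 0 1 ×ˢ Icc 1 3) →
    (∀ x ∈ Icc (0:ℝ) 1, ∀ y ∈ Icc (1:ℝ) 3,
      HasDerivAt (fun s => f s y) (u x y) x ∧ HasDerivAt (fun s => u s y) (ux x y) x ∧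
      HasDerivAt (fun s => v s y) (vx x y) x ∧
      HasDerivAt (fun t => f x t) (v x y) y ∧ HasDerivAt (fun t => v x t) (v1 x y) y ∧
      HasDerivAt (fun t => v1 x t) (v2 x y) y ∧
      HasDerivAt (fun t => u x t) (u1 x y) y ∧ HasDerivAt (fun t => u1 x t) (u2 x y) y ∧
      c ≤ a x y ∧ a x y ≤ C ∧ |f x y| ≤ C ∧ |R x y| ≤ C ∧
      u x y = a x y * v1 x y + R x y ∧
      |vx x y - a x y * v2 x y| ≤ C * (1 + |v x y| + |v1 x y|) ∧
      |ux x y - a x y * u2 x y| ≤ C * (1 + |u x y|)) →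
    |u 1 2| ≤ K ∧ |v 1 2| ≤ K := by
  set K1 : ℝ := 2 + 200 * C with hK1
  set K2 : ℝ := 1 + 100 * C + 2 * C ^ 2 / c with hK2
  set B1 : ℝ := 4 * C ^ 2 * K1 / c + 1 with hB1
  set B0 : ℝ := B1 * K2 / (2 * c) with hB0
  set B : ℝ := 2 * B0 * C ^ 2 + B1 * C + 2 * C + 2 * C ^ 2 * K1 + 1 with hB
  have pK1 : 0 < K1 := by positivity
  have pK2 : 0 < K2 := by positivity
  have pB1 : 0 < B1 := by positivity
  have pB0 : 0 < B0 := by positivity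
  have pB : 0 < B := by positivity
  refine ⟨B0 * C ^ 2 + B + 1, by positivity, ?_⟩
  intro f u ux u1 u2 v vx v1 v2 a R hfc huc hvc H
  set η : ℝ → ℝ := fun y => (y - 1) * (3 - y) with hη
  have hηd : ∀ y, HasDerivAt η (4 - 2 * y) y := by
    intro y
    have := ((hasDerivAt_id y).sub_const 1).mul ((hasDerivAt_id y).const_sub 3)
    refine this.congr_deriv ?_
    simp; ring
  have hηd' : ∀ y, HasDerivAt (fun y : ℝ => 4 - 2 * y) (-2) y := by
    intro y
    have := ((hasDerivAt_id y).const_mul 2).const_sub 4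
    refine this.congr_deriv ?_
    simp
  set Z : ℝ → ℝ → ℝ := fun x y => B0 * f x y ^ 2 + B1 * (x * η y ^ 2 * v x y ^ 2)
    + x ^ 2 * η y ^ 4 * u x y ^ 2 - B * x with hZ
  have hZc : ContinuousOn (fun z : ℝ × ℝ => Z z.1 z.2) (Icc 0 1 ×ˢ Icc 1 3) := by
    simp only [hZ, hη]
    fun_prop
  have hcomp : IsCompact (Icc (0:ℝ) 1 ×ˢ Icc (1:ℝ) 3) := isCompact_Icc.prod isCompact_Icc
  obtain ⟨⟨x0, y0⟩, hz0, hm⟩ := hcomp.exists_isMaxOn ⟨(0, 1), by simp⟩ hZc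
  have hx0 : x0 ∈ Icc (0:ℝ) 1 := hz0.1
  have hy0 : y0 ∈ Icc (1:ℝ) 3 := hz0.2
  have hmax : ∀ x ∈ Icc (0:ℝ) 1, ∀ y ∈ Icc (1:ℝ) 3, Z x y ≤ Z x0 y0 := fun x hx y hy =>
    hm (show (x, y) ∈ _ from ⟨hx, hy⟩)
  have hfb : ∀ x ∈ Icc (0:ℝ) 1, ∀ y ∈ Icc (1:ℝ) 3, f x y ^ 2 ≤ C ^ 2 := by
    intro x hx y hy
    obtain ⟨-, -, -, -, -, -, -, -, -, -, hf, -⟩ := H x hx y hy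
    exact sq_le_sq' (by linarith [abs_le.mp hf]) (by linarith [abs_le.mp hf])
  have hbound : Z x0 y0 ≤ B0 * C ^ 2 := by
    have h1 := mul_le_mul_of_nonneg_left (hfb x0 hx0 y0 hy0) pB0.le
    by_cases hxi : x0 = 0
    · simp only [hZ, hxi] at h1 ⊢; simp; linarith
    by_cases hyi : y0 = 1
    · simp only [hZ, hη, hyi] at h1 ⊢; simp; nlinarith [hx0.1]
    by_cases hyi' : y0 = 3
    · simp only [hZ, hη, hyi'] at h1 ⊢; simp; nlinarith [hx0.1]
    exfalso
    have hxI : x0 ∈ Ioc (0:ℝ) 1 := ⟨lt_of_le_of_ne hx0.1 (Ne.symm hxi), hx0.2⟩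
    have hyI : y0 ∈ Ioo (1:ℝ) 3 :=
      ⟨lt_of_le_of_ne hy0.1 (Ne.symm hyi), lt_of_le_of_ne hy0.2 hyi'⟩
    obtain ⟨d1, d2, d3, d4, d5, d6, d7, d8, hca, haC, hf, hR, hu, hEv, hEu⟩ := H x0 hx0 y0 hy0
    obtain ⟨q1, q2⟩ := at_max (Z := Z) 
      (Zx := B0 * (2 * f x0 y0 * u x0 y0) + B1 * (η y0 ^ 2 * v x0 y0 ^ 2
        + x0 * η y0 ^ 2 * (2 * v x0 y0 * vx x0 y0)) + (2 * x0 * η y0 ^ 4 * u x0 y0 ^ 2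
        + x0 ^ 2 * η y0 ^ 4 * (2 * u x0 y0 * ux x0 y0)) - B)
      (Zy := fun y => B0 * (2 * f x0 y * v x0 y) + B1 * (x0 * (2 * η y * (4 - 2 * y)) * v x0 y ^ 2
        + x0 * η y ^ 2 * (2 * v x0 y * v1 x0 y)) + (x0 ^ 2 * (4 * η y ^ 3 * (4 - 2 * y))
          * u x0 y ^ 2 + x0 ^ 2 * η y ^ 4 * (2 * u x0 y * u1 x0 y)))
      (Zyy := B0 * (2 * v x0 y0 * v x0 y0 + 2 * f x0 y0 * v1 x0 y0)
        + B1 * ((x0 * (2 * (4 - 2 * y0) * (4 - 2 * y0) + 2 * η y0 * (-2)) * v x0 y0 ^ 2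
          + x0 * (2 * η y0 * (4 - 2 * y0)) * (2 * v x0 y0 * v1 x0 y0))
          + (x0 * (2 * η y0 * (4 - 2 * y0)) * (2 * v x0 y0 * v1 x0 y0)
           + x0 * η y0 ^ 2 * (2 * v1 x0 y0 * v1 x0 y0 + 2 * v x0 y0 * v2 x0 y0)))
        + ((x0 ^ 2 * (4 * (3 * η y0 ^ 2 * (4 - 2 * y0)) * (4 - 2 * y0) + 4 * η y0 ^ 3 * (-2))
            * u x0 y0 ^ 2
            + x0 ^ 2 * (4 * η y0 ^ 3 * (4 - 2 * y0)) * (2 * u x0 y0 * u1 x0 y0))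
          + (x0 ^ 2 * (4 * η y0 ^ 3 * (4 - 2 * y0)) * (2 * u x0 y0 * u1 x0 y0)
            + x0 ^ 2 * η y0 ^ 4 * (2 * u1 x0 y0 * u1 x0 y0 + 2 * u x0 y0 * u2 x0 y0))))
      hxI hyI hmax
      (by
        have hi := hasDerivAt_id x0
        have := ((((d1.pow 2).const_mul B0).add
          (((hi.mul_const (η y0 ^ 2)).mul (d3.pow 2)).const_mul B1)).add
          (((hi.pow 2).mul_const (η y0 ^ 4)).mul (d2.pow 2))).sub (hi.const_mul B)
        refine this.congr_deriv ?_
        simp only [Pi.pow_apply, id, Pi.mul_apply]; push_cast; ring)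
      (by
        intro y hy
        obtain ⟨-, -, -, d4, d5, d6, d7, d8, -⟩ := H x0 hx0 y ⟨hy.1.le, hy.2.le⟩
        have hi := hηd y
        have := ((((d4.pow 2).const_mul B0).add
          ((((hi.pow 2).const_mul x0).mul (d5.pow 2)).const_mul B1)).add
          (((hi.pow 4).const_mul (x0 ^ 2)).mul (d7.pow 2))).sub_const (B * x0)
        refine this.congr_deriv ?_
        simp only [Pi.pow_apply, id, Pi.mul_apply]; push_cast; ring)
      (by
        have hi := hηd y0
        have hi' := hηd' y0
        have := (((((d4.const_mul 2).mul d5).const_mul B0).add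
          ((((((hi.const_mul 2).mul hi').const_mul x0).mul (d5.pow 2)).add
            (((hi.pow 2).const_mul x0).mul ((d5.const_mul 2).mul d6))).const_mul B1)).add
          ((((((hi.pow 3).const_mul 4).mul hi').const_mul (x0 ^ 2)).mul (d7.pow 2)).add
            (((hi.pow 4).const_mul (x0 ^ 2)).mul ((d7.const_mul 2).mul d8))))
        refine this.congr_deriv ?_
        simp only [Pi.pow_apply, id, Pi.mul_apply]; push_cast; ring)
    have hη0 : 0 ≤ η y0 := mul_nonneg (by linarith [hyI.1]) (by linarith [hyI.2])
    have hη1 : η y0 ≤ 1 := by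
      simp only [hη]
      have := sq_nonneg (y0 - 2)
      linarith
    have hη' : (4 - 2 * y0) ^ 2 ≤ 4 := by
      have := mul_nonneg (sub_nonneg.mpr hy0.1) (sub_nonneg.mpr hy0.2)
      linarith
    exact bern_point c C K1 K2 B1 B0 B hc hC hK1 hK2 hB1 hB0 hB pK1 pK2 pB1 pB0 _ _ _ _ _ _ _ _ _ _ _ _ _
      hx0 hη0 hη1 hη' hca haC hf hR hu hEv hEu q1 q2
  have h12 := hmax 1 (by norm_num) 2 (by norm_num)
  have hη2 : η 2 = 1 := by simp only [hη]; norm_num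
  have hZ2 : Z 1 2 = B0 * f 1 2 ^ 2 + B1 * v 1 2 ^ 2 + u 1 2 ^ 2 - B := by
    simp only [hZ, hη2]; ring
  have hB11 : 1 ≤ B1 := by
    rw [hB1]
    have : 0 ≤ 4 * C ^ 2 * K1 / c := by positivity
    linarith
  have p1 : 0 ≤ B0 * f 1 2 ^ 2 := by positivity
  have p2 : v 1 2 ^ 2 ≤ B1 * v 1 2 ^ 2 := by nlinarith [sq_nonneg (v 1 2)]
  have p3 : 0 ≤ B0 * C ^ 2 := by positivity
  have p4 := sq_nonneg (v 1 2)
  have p5 := sq_nonneg (u 1 2)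
  have p6 : ∀ t : ℝ, t ^ 2 ≤ B0 * C ^ 2 + B → |t| ≤ B0 * C ^ 2 + B + 1 := by
    intro t ht
    generalize B0 * C ^ 2 + B = q at *
    have := sq_abs t
    nlinarith [abs_nonneg t]
  exact ⟨p6 _ (by linarith), p6 _ (by linarith)⟩



structure Ctx (X δ m M : ℝ) (w : ℝ → ℝ → ℝ) (g : ℝ → ℝ) : Prop where
  hX : 0 < X
  hδ0 : 0 < δ
  hδ1 : δ ≤ 1
  hm : 0 < m
  hmM : m < M
  sm : Sm (Ioo 0 X ×ˢ Ioo 0 δ) w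
  hg : ContDiff ℝ (⊤ : ℕ∞) g
  eqn : ∀ x ∈ Ioo 0 X, ∀ y ∈ Ioo 0 δ, WW w 1 x y = √(w x y) * Dy (Dy w) x y + g x
  lb : ∀ x ∈ Ioo 0 X, ∀ y ∈ Ioo 0 δ, m * y < w x y
  ub : ∀ x ∈ Ioo 0 X, ∀ y ∈ Ioo 0 δ, w x y < M * y
  slope : ∀ x ∈ Ioo 0 X, ∀ y ∈ Ioo 0 δ, |Dy w x y| ≤ M

lemma isOpenU (X δ : ℝ) : IsOpen (Ioo 0 X ×ˢ Ioo 0 δ) := isOpen_Ioo.prod isOpen_Ioo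

lemma Ctx.wpos {X δ m M : ℝ} {w : ℝ → ℝ → ℝ} {g : ℝ → ℝ} (H : Ctx X δ m M w g) {x y : ℝ}
    (hx : x ∈ Ioo 0 X) (hy : y ∈ Ioo 0 δ) : 0 < w x y :=
  lt_trans (mul_pos H.hm hy.1) (H.lb x hx y hy)

lemma Ctx.smW {X δ m M : ℝ} {w : ℝ → ℝ → ℝ} {g : ℝ → ℝ} (H : Ctx X δ m M w g) (k : ℕ) :
    Sm (Ioo 0 X ×ˢ Ioo 0 δ) (WW w k) := H.sm.WW (isOpenU X δ) k

inductive Alg (w : ℝ → ℝ → ℝ) (g : ℝ → ℝ) (k : ℕ) : (ℝ → ℝ → ℝ) → Prop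
  | const (c : ℝ) : Alg w g k (fun _ _ => c)
  | src (j : ℕ) : Alg w g k (fun x _ => iteratedDeriv j g x)
  | W (j : ℕ) (h : j ≤ k) : Alg w g k (WW w j)
  | rat (j : ℕ) (h : j ≤ k) : Alg w g k (fun x y => WW w j x y / w x y)
  | add {φ χ : ℝ → ℝ → ℝ} (h1 : Alg w g k φ) (h2 : Alg w g k χ) :
      Alg w g k (fun x y => φ x y + χ x y)
  | mul {φ χ : ℝ → ℝ → ℝ} (h1 : Alg w g k φ) (h2 : Alg w g k χ) :
      Alg w g k (fun x y => φ x y * χ x y)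

lemma Alg.succ {w : ℝ → ℝ → ℝ} {g : ℝ → ℝ} {k : ℕ} {φ : ℝ → ℝ → ℝ} (h : Alg w g k φ) :
    Alg w g (k+1) φ := by
  induction h with
  | const c => exact .const c
  | src j => exact .src j
  | W j h => exact .W j (by omega)
  | rat j h => exact .rat j (by omega)
  | add _ _ h1 h2 => exact .add h1 h2
  | mul _ _ h1 h2 => exact .mul h1 h2

lemma hasDeriv_src {g : ℝ → ℝ} (hg : ContDiff ℝ (⊤ : ℕ∞) g) (j : ℕ) (x : ℝ) :
    HasDerivAt (iteratedDeriv j g) (iteratedDeriv (j+1) g x) x := by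
  rw [iteratedDeriv_succ]
  apply DifferentiableAt.hasDerivAt
  have := hg.differentiable_iteratedDeriv j (by exact_mod_cast WithTop.coe_lt_top _)
  exact this x

lemma Alg.sm {X δ m M : ℝ} {w : ℝ → ℝ → ℝ} {g : ℝ → ℝ} (H : Ctx X δ m M w g) {k : ℕ}
    {φ : ℝ → ℝ → ℝ} (h : Alg w g k φ) : Sm (Ioo 0 X ×ˢ Ioo 0 δ) φ := by
  induction h with
  | const c => exact contDiffOn_const
  | src j =>
    have h1 : ContDiff ℝ (⊤ : ℕ∞) (iteratedDeriv j g) := by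
      rw [iteratedDeriv_eq_iterate]
      exact H.hg.iterate_deriv j
    exact (h1.comp contDiff_fst).contDiffOn
  | W j h => exact H.smW j
  | rat j h => exact ContDiffOn.div (H.smW j) H.sm (fun z hz => (H.wpos hz.1 hz.2).ne')
  | add _ _ h1 h2 => exact ContDiffOn.add h1 h2
  | mul _ _ h1 h2 => exact ContDiffOn.mul h1 h2

lemma Alg.dx {X δ m M : ℝ} {w : ℝ → ℝ → ℝ} {g : ℝ → ℝ} (H : Ctx X δ m M w g) {k : ℕ}
    {φ : ℝ → ℝ → ℝ} (h : Alg w g k φ) : ∃ φ', Alg w g (k+1) φ' ∧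
    ∀ x ∈ Ioo 0 X, ∀ y ∈ Ioo 0 δ, HasDerivAt (fun s => φ s y) (φ' x y) x := by
  have hW : ∀ j, ∀ x ∈ Ioo 0 X, ∀ y ∈ Ioo 0 δ,
      HasDerivAt (fun s => WW w j s y) (WW w (j+1) x y) x := by
    intro j x hx y hy
    have := (H.smW j).hasDx (isOpenU X δ) (show (x, y) ∈ _ from ⟨hx, hy⟩)
    rwa [Dx_WW] at this
  induction h with
  | const c => exact ⟨_, .const 0, fun x _ y _ => hasDerivAt_const _ _⟩
  | src j => exact ⟨_, .src (j+1), fun x _ y _ => hasDeriv_src H.hg j x⟩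
  | W j h => exact ⟨_, .W (j+1) (by omega), hW j⟩
  | rat j h =>
    refine ⟨_, .add (.rat (j+1) (by omega)) (.mul (.const (-1)) (.mul (.rat j (by omega))
      (.rat 1 (by omega)))), ?_⟩
    intro x hx y hy
    have h0 := hW 0 x hx y hy
    rw [WW_zero] at h0
    have hw := (H.wpos hx hy).ne'
    refine ((hW j x hx y hy).div h0 hw).congr_deriv ?_
    simp only [zero_add]
    field_simp
    ring
  | add _ _ h1 h2 =>
    obtain ⟨a, ha, hda⟩ := h1
    obtain ⟨b, hb, hdb⟩ := h2
    exact ⟨_, .add ha hb, fun x hx y hy => (hda x hx y hy).add (hdb x hx y hy)⟩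
  | mul p q h1 h2 =>
    obtain ⟨a, ha, hda⟩ := h1
    obtain ⟨b, hb, hdb⟩ := h2
    exact ⟨_, .add (.mul ha q.succ) (.mul p.succ hb),
      fun x hx y hy => (hda x hx y hy).mul (hdb x hx y hy)⟩

lemma eqn_next {X δ m M : ℝ} {w : ℝ → ℝ → ℝ} {g : ℝ → ℝ} (H : Ctx X δ m M w g) {k : ℕ}
    {R : ℝ → ℝ → ℝ} {R' : ℝ}
    (hE : ∀ x ∈ Ioo 0 X, ∀ y ∈ Ioo 0 δ,
      WW w (k+1) x y = √(w x y) * Dy (Dy (WW w k)) x y + R x y)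
    {x y : ℝ} (hx : x ∈ Ioo 0 X) (hy : y ∈ Ioo 0 δ)
    (hR : HasDerivAt (fun s => R s y) R' x) :
    WW w (k+2) x y = √(w x y) * Dy (Dy (WW w (k+1))) x y +
      (R' + (1 / 2) * (WW w 1 x y / w x y) * (WW w (k+1) x y - R x y)) := by
  have hU := isOpenU X δ
  have hz : (x, y) ∈ Ioo 0 X ×ˢ Ioo 0 δ := ⟨hx, hy⟩
  have h1 : Dx (WW w (k+1)) x y =
      Dx (fun x y => √(w x y) * Dy (Dy (WW w k)) x y + R x y) x y :=
    Dx_congr hU (fun x y h => hE x h.1 y h.2) hz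
  rw [Dx_WW] at h1
  have hw := H.wpos hx hy
  have d0 := H.sm.hasDx hU hz
  have hw1 : Dx w x y = WW w 1 x y := by
    have := Dx_WW w 0
    rw [WW_zero] at this
    rw [this]
  rw [hw1] at d0
  have d1 := d0.sqrt hw.ne'
  have d2 := (((H.smW k).dy hU).dy hU).hasDx hU hz
  have hcomm : Dx (Dy (Dy (WW w k))) x y = Dy (Dy (WW w (k+1))) x y := by
    rw [((H.smW k).dy hU).comm hU hz]
    rw [← Dx_WW]
    exact Dy_congr hU (fun x y h => (H.smW k).comm hU h) hz
  rw [hcomm] at d2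
  have d3 := ((d1.mul d2).add hR).deriv
  have h2 : Dx (fun x y => √(w x y) * Dy (Dy (WW w k)) x y + R x y) x y = _ := d3
  rw [h1, h2, hE x hx y hy]
  have hs : √(w x y) ≠ 0 := (Real.sqrt_pos.mpr hw).ne'
  have hss : √(w x y) * √(w x y) = w x y := Real.mul_self_sqrt hw.le
  have : WW w 1 x y / w x y = WW w 1 x y / (√(w x y) * √(w x y)) := by rw [hss]
  rw [this]
  field_simp
  ring

lemma eqnk {X δ m M : ℝ} {w : ℝ → ℝ → ℝ} {g : ℝ → ℝ} (H : Ctx X δ m M w g) (k : ℕ) :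
    ∃ R, Alg w g k R ∧ ∀ x ∈ Ioo 0 X, ∀ y ∈ Ioo 0 δ,
      WW w (k+1) x y = √(w x y) * Dy (Dy (WW w k)) x y + R x y := by
  induction k with
  | zero =>
    refine ⟨_, .src 0, ?_⟩
    intro x hx y hy
    have := H.eqn x hx y hy
    simpa [WW_zero] using this
  | succ k ih =>
    obtain ⟨R, hR, hE⟩ := ih
    obtain ⟨R', hR', hd⟩ := hR.dx H
    refine ⟨_, .add hR' (.mul (.mul (.const (1/2)) (.rat 1 (by omega)))
      (.add (.W (k+1) le_rfl) (.mul (.const (-1)) hR.succ))), ?_⟩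
    intro x hx y hy
    have := eqn_next H hE hx hy (hd x hx y hy)
    rw [this]
    ring

structure Bd (X : ℝ) (w : ℝ → ℝ → ℝ) (k : ℕ) (ε δ C : ℝ) : Prop where
  b1 : ∀ x ∈ Ioo ε X, ∀ y ∈ Ioo 0 δ, ∀ j, 1 ≤ j → j ≤ k → |WW w j x y| ≤ C * y
  b2 : ∀ x ∈ Ioo ε X, ∀ y ∈ Ioo 0 δ, ∀ j, j < k → |Dy (WW w j) x y| ≤ C

lemma Wbounds {X δ m M : ℝ} {w : ℝ → ℝ → ℝ} {g : ℝ → ℝ} (H : Ctx X δ m M w g) {k : ℕ}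
    (hk : 1 ≤ k) {ε δ' C : ℝ} (hε : 0 ≤ ε) (hδ' : δ' ≤ δ) (hC : 0 ≤ C) (B : Bd X w k ε δ' C) :
    ∀ j ≤ k, ∀ x ∈ Ioo ε X, ∀ x' ∈ Ioo ε X, ∀ y ∈ Ioo 0 δ',
      |WW w j x y| ≤ (C + M + 1) * y ∧ |Dy (WW w j) x y| ≤ (C + M + 1) * (1 + |Dy (WW w k) x y|) ∧
      |WW w j x y - WW w j x' y| ≤
        (C + M + 1) * (y * (|x - x'| + |WW w k x y - WW w k x' y| / y)) := by
  intro j hj x hx x' hx' y hy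
  have hxX : x ∈ Ioo 0 X := ⟨by linarith [hx.1], hx.2⟩
  have hyδ : y ∈ Ioo 0 δ := ⟨hy.1, by linarith [hy.2]⟩
  have hM : 0 < M := H.hm.trans H.hmM
  have hy0 := hy.1
  refine ⟨?_, ?_, ?_⟩
  · rcases Nat.eq_zero_or_pos j with rfl | h
    · rw [WW_zero, abs_of_pos (H.wpos hxX hyδ)]
      have := H.ub x hxX y hyδ
      nlinarith
    · have := B.b1 x hx y hy j h hj
      nlinarith
  · have h0 := abs_nonneg (Dy (WW w k) x y)
    rcases Nat.lt_or_ge j k with h | h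
    · have := B.b2 x hx y hy j h
      nlinarith
    · obtain rfl : j = k := le_antisymm hj h
      nlinarith
  · have h0 := abs_nonneg (WW w k x y - WW w k x' y)
    have h1 := abs_nonneg (x - x')
    have he : y * (|x - x'| + |WW w k x y - WW w k x' y| / y) =
        y * |x - x'| + |WW w k x y - WW w k x' y| := by field_simp
    rw [he]
    rcases Nat.lt_or_ge j k with h | h
    · have hmv := Convex.norm_image_sub_le_of_norm_hasDerivWithin_le (𝕜 := ℝ)
        (f := fun s => WW w j s y) (f' := fun s => WW w (j+1) s y) (C := C * y) (s := Ioo ε X)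
        (x := x') (y := x) (fun s hs => by
          have := (H.smW j).hasDx (isOpenU X δ) (x := s) (y := y)
            ⟨⟨by linarith [hs.1], hs.2⟩, hyδ⟩
          rw [Dx_WW] at this
          exact this.hasDerivWithinAt)
        (fun s hs => by
          have := B.b1 s hs y hy (j+1) (by omega) (by omega)
          simpa using this) (convex_Ioo _ _) hx' hx
      simp only [Real.norm_eq_abs] at hmv
      have : 0 ≤ y * |x - x'| := by positivity
      nlinarith
    · obtain rfl : j = k := le_antisymm hj h
      have : 0 ≤ y * |x - x'| := by positivity
      nlinarith

def AB (X : ℝ) (w : ℝ → ℝ → ℝ) (k : ℕ) (ε δ : ℝ) (φ : ℝ → ℝ → ℝ) (K : ℝ) : Prop :=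
  ∀ x ∈ Ioo ε X, ∀ x' ∈ Ioo ε X, ∀ y ∈ Ioo 0 δ,
    |φ x y| ≤ K ∧ |Dy φ x y| ≤ K * ((1 + |Dy (WW w k) x y|) / y) ∧
    |φ x y - φ x' y| ≤ K * (|x - x'| + |WW w k x y - WW w k x' y| / y)

set_option maxHeartbeats 4000000 in
lemma AlgB {X δ m M : ℝ} {w : ℝ → ℝ → ℝ} {g : ℝ → ℝ} (H : Ctx X δ m M w g) {k : ℕ}
    (hk : 1 ≤ k) {ε δ' C : ℝ} (hε : 0 ≤ ε) (hδ' : δ' ≤ δ) (hC : 0 ≤ C) (B : Bd X w k ε δ' C)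
    {φ : ℝ → ℝ → ℝ} (h : Alg w g k φ) : ∃ K, 0 ≤ K ∧ AB X w k ε δ' φ K := by
  have hWb := Wbounds H hk hε hδ' hC B
  have hM : 0 < M := H.hm.trans H.hmM
  have hm := H.hm
  set K0 := C + M + 1 with hK0
  have pK0 : 0 < K0 := by positivity
  have hsub : ∀ x ∈ Ioo ε X, x ∈ Ioo 0 X := fun x hx => ⟨by linarith [hx.1], hx.2⟩
  have hsuby : ∀ y ∈ Ioo 0 δ', y ∈ Ioo 0 δ := fun y hy => ⟨hy.1, by linarith [hy.2]⟩
  induction h with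
  | const c =>
    refine ⟨|c|, abs_nonneg c, fun x hx x' hx' y hy => ⟨le_rfl, ?_, ?_⟩⟩
    · have hy0 := hy.1
      simp only [Dy, deriv_const, abs_zero]
      positivity
    · have hy0 := hy.1
      simp only [sub_self, abs_zero]
      positivity
  | src j =>
    have hc : ∀ i, Continuous (iteratedDeriv i g) := fun i =>
      (continuous_iff_continuousAt.mpr fun x => (hasDeriv_src H.hg i x).continuousAt)
    obtain ⟨A1, hA1⟩ := isCompact_Icc.exists_bound_of_continuousOn
      (s := Icc 0 X) (hc j).continuousOn
    obtain ⟨A2, hA2⟩ := isCompact_Icc.exists_bound_of_continuousOn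
      (s := Icc 0 X) (hc (j+1)).continuousOn
    have h0 : (0:ℝ) ∈ Icc 0 X := ⟨le_rfl, H.hX.le⟩
    have p1 : 0 ≤ A1 := (norm_nonneg _).trans (hA1 0 h0)
    have p2 : 0 ≤ A2 := (norm_nonneg _).trans (hA2 0 h0)
    refine ⟨A1 + A2, by positivity, fun x hx x' hx' y hy => ⟨?_, ?_, ?_⟩⟩
    · have := hA1 x ⟨by linarith [hx.1], hx.2.le⟩
      rw [Real.norm_eq_abs] at this
      linarith
    · have hy0 := hy.1
      simp only [Dy, deriv_const, abs_zero]
      positivity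
    · have hy0 := hy.1
      have hmv := Convex.norm_image_sub_le_of_norm_hasDerivWithin_le (𝕜 := ℝ)
        (f := iteratedDeriv j g) (f' := iteratedDeriv (j+1) g) (C := A2) (s := Icc 0 X)
        (x := x') (y := x) (fun s hs => (hasDeriv_src H.hg j s).hasDerivWithinAt)
        (fun s hs => hA2 s hs) (convex_Icc _ _) ⟨by linarith [hx'.1], hx'.2.le⟩
        ⟨by linarith [hx.1], hx.2.le⟩
      simp only [Real.norm_eq_abs] at hmv
      have q1 : 0 ≤ |WW w k x y - WW w k x' y| / y := by positivity
      have q2 := abs_nonneg (x - x')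
      nlinarith
  | W j h =>
    refine ⟨K0, pK0.le, fun x hx x' hx' y hy => ?_⟩
    obtain ⟨h1, h2, h3⟩ := hWb j h x hx x' hx' y hy
    have hy0 := hy.1
    have hy1 : y ≤ 1 := by linarith [hy.2, H.hδ1]
    refine ⟨by nlinarith, h2.trans ?_, h3.trans ?_⟩
    · apply mul_le_mul_of_nonneg_left _ pK0.le
      rw [le_div_iff₀ hy0]
      have : 0 ≤ 1 + |Dy (WW w k) x y| := by positivity
      nlinarith
    · apply mul_le_mul_of_nonneg_left _ pK0.le
      have : 0 ≤ |x - x'| + |WW w k x y - WW w k x' y| / y := by positivity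
      nlinarith
  | rat j h =>
    refine ⟨K0 / m + 2 * K0 * K0 / m ^ 2, by positivity, fun x hx x' hx' y hy => ?_⟩
    obtain ⟨h1, h2, h3⟩ := hWb j h x hx x' hx' y hy
    obtain ⟨h1', h2', h3'⟩ := hWb j h x' hx' x hx y hy
    obtain ⟨g1, g2, g3⟩ := hWb 0 (by omega) x hx x' hx' y hy
    obtain ⟨g1', g2', g3'⟩ := hWb 0 (by omega) x' hx' x hx y hy
    rw [WW_zero] at g1 g2 g3 g1'
    have hy0 := hy.1
    have hw := H.wpos (hsub x hx) (hsuby y hy)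
    have hw' := H.wpos (hsub x' hx') (hsuby y hy)
    have lw := H.lb x (hsub x hx) y (hsuby y hy)
    have lw' := H.lb x' (hsub x' hx') y (hsuby y hy)
    have e1 : 0 ≤ K0 / m := by positivity
    have e2 : 0 ≤ 2 * K0 * K0 / m ^ 2 := by positivity
    refine ⟨?_, ?_, ?_⟩
    · rw [abs_div, abs_of_pos hw, div_le_iff₀ hw]
      have : K0 / m * (m * y) = K0 * y := by field_simp
      have : K0 / m * (m * y) ≤ (K0 / m + 2 * K0 * K0 / m ^ 2) * w x y :=
        mul_le_mul (by linarith) lw.le (by positivity) (by positivity)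
      linarith
    · have hz : (x, y) ∈ Ioo 0 X ×ˢ Ioo 0 δ := ⟨hsub x hx, hsuby y hy⟩
      have hd := (((H.smW j).hasDy (isOpenU X δ) hz).div (H.sm.hasDy (isOpenU X δ) hz) hw.ne').deriv
      have hd' : Dy (fun x y => WW w j x y / w x y) x y = _ := hd
      rw [hd', abs_div, abs_of_pos (show 0 < w x y ^ 2 by positivity), div_le_iff₀ (by positivity)]
      set q := 1 + |Dy (WW w k) x y| with hq
      have pq : 1 ≤ q := by have := abs_nonneg (Dy (WW w k) x y); linarith
      have hsl := H.slope x (hsub x hx) y (hsuby y hy)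
      have n1 : |Dy (WW w j) x y * w x y - WW w j x y * Dy w x y| ≤ 2 * K0 * K0 * q * y := by
        refine (abs_sub _ _).trans ?_
        rw [abs_mul, abs_mul]
        have a1 := mul_le_mul h2 g1 (abs_nonneg _) (by positivity)
        have a2 := mul_le_mul h1 hsl (abs_nonneg _) (by positivity)
        have a3 : K0 * y * M ≤ K0 * y * (K0 * q) := by
          apply mul_le_mul_of_nonneg_left _ (by positivity)
          nlinarith
        linarith
      refine n1.trans ?_
      have n2 : (m * y) ^ 2 ≤ w x y ^ 2 := pow_le_pow_left₀ (by positivity) lw.le 2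
      have n3 : 2 * K0 * K0 / m ^ 2 * (q / y) * (m * y) ^ 2 = 2 * K0 * K0 * q * y := by
        field_simp
      rw [← n3]
      apply mul_le_mul _ n2 (by positivity) (by positivity)
      apply mul_le_mul_of_nonneg_right (by linarith) (by positivity)
    · set d := |x - x'| + |WW w k x y - WW w k x' y| / y with hd
      have pd : 0 ≤ d := by positivity
      have n0 : WW w j x y / w x y - WW w j x' y / w x' y =
        ((WW w j x y - WW w j x' y) * w x' y - WW w j x' y * (w x y - w x' y)) /
          (w x y * w x' y) := by
        field_simp; ring
      rw [n0, abs_div, abs_of_pos (show 0 < w x y * w x' y by positivity),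
        div_le_iff₀ (by positivity)]
      have n1 : |(WW w j x y - WW w j x' y) * w x' y - WW w j x' y * (w x y - w x' y)| ≤
          2 * K0 * K0 * d * y ^ 2 := by
        refine (abs_sub _ _).trans ?_
        rw [abs_mul, abs_mul]
        have a1 := mul_le_mul h3 g1' (abs_nonneg _) (by positivity)
        have a2 := mul_le_mul h1' g3 (abs_nonneg _) (by positivity)
        linarith
      refine n1.trans ?_
      have n2 : (m * y) * (m * y) ≤ w x y * w x' y :=
        mul_le_mul lw.le lw'.le (by positivity) hw.le
      have n3 : 2 * K0 * K0 / m ^ 2 * d * ((m * y) * (m * y)) = 2 * K0 * K0 * d * y ^ 2 := by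
        field_simp
      rw [← n3]
      apply mul_le_mul _ n2 (by positivity) (by positivity)
      apply mul_le_mul_of_nonneg_right (by linarith) (by positivity)
  | add p1 p2 h1 h2 =>
    obtain ⟨A1, q1, h1⟩ := h1
    obtain ⟨A2, q2, h2⟩ := h2
    refine ⟨A1 + A2, by positivity, fun x hx x' hx' y hy => ?_⟩
    obtain ⟨a1, a2, a3⟩ := h1 x hx x' hx' y hy
    obtain ⟨b1, b2, b3⟩ := h2 x hx x' hx' y hy
    have hz : (x, y) ∈ Ioo 0 X ×ˢ Ioo 0 δ := ⟨hsub x hx, hsuby y hy⟩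
    refine ⟨(abs_add_le _ _).trans (by linarith), ?_, ?_⟩
    · have hd := (((p1.sm H).hasDy (isOpenU X δ) hz).add ((p2.sm H).hasDy (isOpenU X δ) hz)).deriv
      have hd' : Dy (fun x y => _ + _) x y = _ := hd
      rw [hd']
      refine (abs_add_le _ _).trans ?_
      rw [add_mul]; exact add_le_add a2 b2
    · rw [add_sub_add_comm]
      refine (abs_add_le _ _).trans ?_
      rw [add_mul]; exact add_le_add a3 b3
  | @mul φ χ p1 p2 h1 h2 =>
    obtain ⟨A1, q1, h1⟩ := h1
    obtain ⟨A2, q2, h2⟩ := h2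
    refine ⟨2 * A1 * A2, by positivity, fun x hx x' hx' y hy => ?_⟩
    obtain ⟨a1, a2, a3⟩ := h1 x hx x' hx' y hy
    obtain ⟨b1, b2, b3⟩ := h2 x hx x' hx' y hy
    obtain ⟨a1', a2', a3'⟩ := h1 x' hx' x hx y hy
    have hz : (x, y) ∈ Ioo 0 X ×ˢ Ioo 0 δ := ⟨hsub x hx, hsuby y hy⟩
    have hy0 := hy.1
    refine ⟨?_, ?_, ?_⟩
    · rw [abs_mul]
      have := mul_le_mul a1 b1 (abs_nonneg _) q1
      nlinarith [mul_nonneg q1 q2]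
    · have hd := (((p1.sm H).hasDy (isOpenU X δ) hz).mul ((p2.sm H).hasDy (isOpenU X δ) hz)).deriv
      have hd' : Dy (fun x y => φ x y * χ x y) x y = _ := hd
      rw [hd']
      refine (abs_add_le _ _).trans ?_
      rw [abs_mul, abs_mul]
      have c1 := mul_le_mul a2 b1 (abs_nonneg _) (by positivity)
      have c2 := mul_le_mul a1 b2 (abs_nonneg _) q1
      linarith
    · have : φ x y * χ x y - φ x' y * χ x' y =
        (φ x y - φ x' y) * χ x y + φ x' y * (χ x y - χ x' y) := by ring
      rw [this]
      refine (abs_add_le _ _).trans ?_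
      rw [abs_mul, abs_mul]
      have c1 := mul_le_mul a3 b1 (abs_nonneg _) (by positivity)
      have c2 := mul_le_mul a1' b3 (abs_nonneg _) q1
      linarith



lemma scx {F : ℝ → ℝ} {D D' c p q t : ℝ} (h : HasDerivAt F D (p + q * t))
    (hD : c * (D * q) = D') : HasDerivAt (fun t => c * F (p + q * t)) D' t := by
  have h1 : HasDerivAt (fun t : ℝ => p + q * t) q t := by
    simpa using ((hasDerivAt_id t).const_mul q).const_add p
  rw [← hD]
  exact (h.comp t h1).const_mul c

lemma scy {F : ℝ → ℝ} {D D' c q t : ℝ} (h : HasDerivAt F D (q * t))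
    (hD : c * (D * q) = D') : HasDerivAt (fun t => c * F (q * t)) D' t := by
  have h1 : HasDerivAt (fun t : ℝ => q * t) q t := by
    simpa using ((hasDerivAt_id t).const_mul q)
  rw [← hD]
  exact (h.comp t h1).const_mul c

lemma AB_dx {X : ℝ} {w : ℝ → ℝ → ℝ} {k : ℕ} {ε δ : ℝ} {φ : ℝ → ℝ → ℝ} {K : ℝ}
    (h : AB X w k ε δ φ K) {x y φ' W' : ℝ} (hx : x ∈ Ioo ε X) (hy : y ∈ Ioo 0 δ)
    (h1 : HasDerivAt (fun s => φ s y) φ' x)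
    (h2 : HasDerivAt (fun s => WW w k s y) W' x) : |φ'| ≤ K * (1 + |W'| / y) := by
  have t1 := h1.tendsto_slope.abs
  have t2 := ((((h2.tendsto_slope.abs).div_const y).const_add 1).const_mul K)
  refine le_of_tendsto_of_tendsto t1 t2 ?_
  have e1 : ∀ᶠ s in nhdsWithin x {x}ᶜ, s ∈ Ioo ε X :=
    nhdsWithin_le_nhds (Ioo_mem_nhds hx.1 hx.2)
  filter_upwards [e1, self_mem_nhdsWithin] with s hs hne
  have hsx : 0 < |s - x| := abs_pos.mpr (sub_ne_zero.mpr hne)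
  have hy0 := hy.1
  have := (h s hs x hx y hy).2.2
  simp only [slope, vsub_eq_sub, smul_eq_mul, abs_mul, abs_inv]
  have e : K * (1 + |s - x|⁻¹ * |WW w k s y - WW w k x y| / y) =
      |s - x|⁻¹ * (K * (|s - x| + |WW w k s y - WW w k x y| / y)) := by
    field_simp
  rw [e]
  exact mul_le_mul_of_nonneg_left this (by positivity)

/-- derivative in y of the equation -/
lemma eqn_dy {X δ m M : ℝ} {w : ℝ → ℝ → ℝ} {g : ℝ → ℝ} (H : Ctx X δ m M w g) {k : ℕ}
    {R : ℝ → ℝ → ℝ} (hR : Alg w g k R)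
    (hE : ∀ x ∈ Ioo 0 X, ∀ y ∈ Ioo 0 δ,
      WW w (k+1) x y = √(w x y) * Dy (Dy (WW w k)) x y + R x y)
    {x y : ℝ} (hx : x ∈ Ioo 0 X) (hy : y ∈ Ioo 0 δ) :
    Dy (WW w (k+1)) x y = √(w x y) * Dy (Dy (Dy (WW w k))) x y +
      (Dy w x y / (2 * √(w x y)) * Dy (Dy (WW w k)) x y + Dy R x y) := by
  have hU := isOpenU X δ
  have hz : (x, y) ∈ Ioo 0 X ×ˢ Ioo 0 δ := ⟨hx, hy⟩
  rw [Dy_congr hU (fun x y h => hE x h.1 y h.2) hz]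
  have hw := H.wpos hx hy
  have d1 := (H.sm.hasDy hU hz).sqrt hw.ne'
  have d2 := (((H.smW k).dy hU).dy hU).hasDy hU hz
  have d3 := ((d1.mul d2).add ((hR.sm H).hasDy hU hz)).deriv
  have h2 : Dy (fun x y => √(w x y) * Dy (Dy (WW w k)) x y + R x y) x y = _ := d3
  rw [h2]
  ring

set_option maxHeartbeats 1000000 in
lemma pt_bounds {X δ m M : ℝ} {w : ℝ → ℝ → ℝ} {g : ℝ → ℝ} (H : Ctx X δ m M w g) {k : ℕ}
    (hk : 1 ≤ k) {ε δ' C : ℝ} (hε : 0 ≤ ε) (hδ' : δ' ≤ δ) (hC : 0 ≤ C) (B : Bd X w k ε δ' C)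
    {R : ℝ → ℝ → ℝ} (hR : Alg w g k R)
    (hE : ∀ x ∈ Ioo 0 X, ∀ y ∈ Ioo 0 δ,
      WW w (k+1) x y = √(w x y) * Dy (Dy (WW w k)) x y + R x y)
    {KR : ℝ} (hKR : 0 ≤ KR) (hAB : AB X w k ε δ' R KR)
    {x y r : ℝ} (hx : x ∈ Ioo ε X) (hy : y ∈ Ioo 0 δ') (hr : 0 < r) (hr1 : r ≤ 1)
    (h1 : r ^ 2 ≤ y) (h3 : y ≤ 3 * r ^ 2) {A : ℝ}
    (hA : A = 1 + √(3 * M) + 3 * C + 3 * KR + M / (2 * √m) + C / m * (1 + KR)) :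
    √m ≤ r⁻¹ * √(w x y) ∧ r⁻¹ * √(w x y) ≤ A ∧ |(r⁻¹) ^ 2 * WW w k x y| ≤ A ∧
    |r * R x y| ≤ A ∧
    |r ^ 3 * Dy (WW w (k+1)) x y - r⁻¹ * √(w x y) * (r ^ 4 * Dy (Dy (Dy (WW w k))) x y)| ≤
      A * (1 + |Dy (WW w k) x y| + |r ^ 2 * Dy (Dy (WW w k)) x y|) ∧
    |r ^ 4 * WW w (k+2) x y - r⁻¹ * √(w x y) * (r ^ 5 * Dy (Dy (WW w (k+1))) x y)| ≤
      A * (1 + |r * WW w (k+1) x y|) := by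
  have hxX : x ∈ Ioo 0 X := ⟨by linarith [hx.1], hx.2⟩
  have hyδ : y ∈ Ioo 0 δ := ⟨hy.1, by linarith [hy.2]⟩
  have hM : 0 < M := H.hm.trans H.hmM
  have hm := H.hm
  have hy0 := hy.1
  have hw := H.wpos hxX hyδ
  have lw := H.lb x hxX y hyδ
  have uw := H.ub x hxX y hyδ
  have hsm : 0 < √m := Real.sqrt_pos.mpr hm
  have n1 : 0 ≤ √(3 * M) := Real.sqrt_nonneg _
  have n2 : 0 ≤ M / (2 * √m) := by positivity
  have n3 : 0 ≤ C / m * (1 + KR) := by positivity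
  obtain ⟨c1, c2, -⟩ := hAB x hx x hx y hy
  have hmr : √m * r ≤ √(w x y) := by
    rw [Real.le_sqrt (by positivity) hw.le, mul_pow, Real.sq_sqrt hm.le]
    nlinarith
  have hMr : √(w x y) ≤ √(3 * M) * r := by
    rw [Real.sqrt_le_left (by positivity), mul_pow, Real.sq_sqrt (by positivity)]
    nlinarith
  have hs : 0 < √(w x y) := Real.sqrt_pos.mpr hw
  have hr2 : r ^ 2 ≤ r := by nlinarith
  have hr3 : r ^ 3 ≤ r := by nlinarith
  refine ⟨?_, ?_, ?_, ?_, ?_, ?_⟩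
  · rw [inv_mul_eq_div, le_div_iff₀ hr]; exact hmr
  · rw [inv_mul_eq_div, div_le_iff₀ hr]
    refine hMr.trans (mul_le_mul_of_nonneg_right ?_ hr.le)
    rw [hA]; linarith
  · rw [abs_mul, abs_of_pos (by positivity), inv_pow, inv_mul_eq_div, div_le_iff₀ (by positivity)]
    have := B.b1 x hx y hy k hk le_rfl
    have q1 : C * y ≤ C * (3 * r ^ 2) := mul_le_mul_of_nonneg_left h3 hC
    have q2 : 3 * C * r ^ 2 ≤ A * r ^ 2 := mul_le_mul_of_nonneg_right (by rw [hA]; linarith) (by positivity)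
    linarith
  · rw [abs_mul, abs_of_pos hr]
    have := mul_le_mul hr1 c1 (abs_nonneg _) zero_le_one
    rw [hA]; linarith
  · have e : r ^ 3 * Dy (WW w (k+1)) x y - r⁻¹ * √(w x y) * (r ^ 4 * Dy (Dy (Dy (WW w k))) x y) =
      (r * (Dy w x y / (2 * √(w x y)))) * (r ^ 2 * Dy (Dy (WW w k)) x y) + r ^ 3 * Dy R x y := by
      rw [eqn_dy H hR hE hxX hyδ]
      field_simp
      ring
    rw [e]
    refine (abs_add_le _ _).trans ?_
    rw [abs_mul, abs_mul (r ^ 3), abs_of_pos (show 0 < r ^ 3 by positivity)]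
    set V := |Dy (WW w k) x y| with hV
    set V1 := |r ^ 2 * Dy (Dy (WW w k)) x y| with hV1
    have pV : 0 ≤ V := abs_nonneg _
    have pV1 : 0 ≤ V1 := abs_nonneg _
    have q1 : |r * (Dy w x y / (2 * √(w x y)))| ≤ M / (2 * √m) := by
      rw [abs_mul, abs_div, abs_of_pos hr, abs_of_pos (show 0 < 2 * √(w x y) by positivity)]
      have hsl := H.slope x hxX y hyδ
      rw [← mul_div_assoc, div_le_div_iff₀ (by positivity) (by positivity)]
      have := mul_le_mul hsl hmr (by positivity) hM.le
      linarith
    have q2 : r ^ 3 * |Dy R x y| ≤ KR * (1 + V) := by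
      have z1 : r ^ 3 ≤ y := by nlinarith
      calc r ^ 3 * |Dy R x y| ≤ y * (KR * ((1 + V) / y)) :=
            mul_le_mul z1 c2 (abs_nonneg _) hy0.le
        _ = KR * (1 + V) := by field_simp
    have q3 := mul_le_mul_of_nonneg_right q1 pV1
    have q4 : M / (2 * √m) * V1 ≤ A * V1 := mul_le_mul_of_nonneg_right (by rw [hA]; linarith) pV1
    have q5 : KR * (1 + V) ≤ A * (1 + V) :=
      mul_le_mul_of_nonneg_right (by rw [hA]; linarith) (by positivity)
    linarith
  · obtain ⟨R', -, hd⟩ := hR.dx H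
    have hd := hd x hxX y hyδ
    have hWd := (H.smW k).hasDx (isOpenU X δ) (show (x, y) ∈ _ from ⟨hxX, hyδ⟩)
    rw [Dx_WW] at hWd
    have hR' := AB_dx hAB hx hy hd hWd
    have e : r ^ 4 * WW w (k+2) x y - r⁻¹ * √(w x y) * (r ^ 5 * Dy (Dy (WW w (k+1))) x y) =
      r ^ 4 * R' x y + (1 / 2) * ((WW w 1 x y / w x y)) * (r ^ 4 * (WW w (k+1) x y - R x y)) := by
      rw [eqn_next H hE hxX hyδ hd]
      field_simp
      ring
    rw [e]
    have hU : |r * WW w (k+1) x y| = r * |WW w (k+1) x y| := by rw [abs_mul, abs_of_pos hr]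
    rw [hU]
    set V := |WW w (k+1) x y| with hV
    have pV : 0 ≤ V := abs_nonneg _
    refine (abs_add_le _ _).trans ?_
    have hr4 : r ^ 4 ≤ r := by nlinarith
    have hr4y : r ^ 4 ≤ r * y := by nlinarith
    have q1 : |r ^ 4 * R' x y| ≤ KR * (1 + r * V) := by
      rw [abs_mul, abs_of_pos (show 0 < r ^ 4 by positivity)]
      have z1 := mul_le_mul_of_nonneg_left hR' (show 0 ≤ r ^ 4 by positivity)
      refine z1.trans ?_
      have z2 : r ^ 4 * (KR * (1 + V / y)) = KR * (r ^ 4 + r ^ 4 * (V / y)) := by ring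
      rw [z2]
      apply mul_le_mul_of_nonneg_left _ hKR
      have z3 : r ^ 4 * (V / y) ≤ (r * y) * (V / y) :=
        mul_le_mul_of_nonneg_right hr4y (by positivity)
      have z4 : (r * y) * (V / y) = r * V := by field_simp
      linarith
    have q2 : |WW w 1 x y / w x y| ≤ C / m := by
      rw [abs_div, abs_of_pos hw, div_le_div_iff₀ hw hm]
      have := B.b1 x hx y hy 1 le_rfl hk
      have z1 := mul_le_mul_of_nonneg_right this hm.le
      have z2 := mul_le_mul_of_nonneg_left lw.le hC
      linarith
    have q3 : |r ^ 4 * (WW w (k+1) x y - R x y)| ≤ (1 + KR) * (1 + r * V) := by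
      rw [abs_mul, abs_of_pos (show 0 < r ^ 4 by positivity)]
      have z1 : |WW w (k+1) x y - R x y| ≤ V + KR := (abs_sub _ _).trans (by linarith)
      have z2 := mul_le_mul hr4 z1 (abs_nonneg _) hr.le
      have z3 : 0 ≤ KR * (r * V) := by positivity
      have z4 : r * KR ≤ KR := mul_le_of_le_one_left hKR hr1
      linarith
    have q4 : |(1 / 2) * ((WW w 1 x y / w x y)) * (r ^ 4 * (WW w (k+1) x y - R x y))| ≤
        C / m * ((1 + KR) * (1 + r * V)) := by
      rw [abs_mul, abs_mul, abs_of_pos (show (0:ℝ) < 1 / 2 by norm_num)]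
      have z := mul_le_mul q2 q3 (abs_nonneg _) (by positivity)
      have z2 : 0 ≤ |WW w 1 x y / w x y| * |r ^ 4 * (WW w (k+1) x y - R x y)| := by positivity
      linarith
    have q5 : (KR + C / m * (1 + KR)) * (1 + r * V) ≤ A * (1 + r * V) := 
      mul_le_mul_of_nonneg_right (by rw [hA]; linarith) (by positivity)
    linarith

set_option maxHeartbeats 1000000 in
lemma interior_est {X δ m M : ℝ} {w : ℝ → ℝ → ℝ} {g : ℝ → ℝ} (H : Ctx X δ m M w g) {k : ℕ}
    (hk : 1 ≤ k) {ε ε2 δ' C : ℝ} (hε : 0 ≤ ε) (hε2 : ε < ε2) (hδ0 : 0 < δ') (hδ' : δ' ≤ δ)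
    (hC : 0 ≤ C) (B : Bd X w k ε δ' C) :
    ∃ K δ2 : ℝ, 0 < K ∧ 0 < δ2 ∧ δ2 ≤ δ' ∧ ∀ x ∈ Ioo ε2 X, ∀ y ∈ Ioo 0 δ2,
      |Dy (WW w k) x y| ≤ K ∧ |WW w (k+1) x y| * √y ≤ K := by
  obtain ⟨R, hR, hE⟩ := eqnk H k
  obtain ⟨KR, hKR, hAB⟩ := AlgB H hk hε hδ' hC B hR
  have hM : 0 < M := H.hm.trans H.hmM
  have hm := H.hm
  have hU := isOpenU X δ
  obtain ⟨A, hA⟩ : ∃ A, A = 1 + √(3 * M) + 3 * C + 3 * KR + M / (2 * √m) + C / m * (1 + KR) :=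
    ⟨_, rfl⟩
  have hA1 : 1 ≤ A := by
    have n1 : 0 ≤ √(3 * M) := Real.sqrt_nonneg _
    have n2 : 0 ≤ M / (2 * √m) := by positivity
    have n3 : 0 ≤ C / m * (1 + KR) := by positivity
    rw [hA]; linarith
  obtain ⟨K, hK, hmain⟩ := bernstein_unit (√m) A (Real.sqrt_pos.mpr hm) hA1
  refine ⟨2 * K, min (δ' / 2) (ε2 - ε), by positivity, lt_min (by linarith) (by linarith),
    (min_le_left _ _).trans (by linarith), ?_⟩
  intro x0 hx0 y0 hy0
  have hyp := hy0.1
  have hyl : y0 < δ' / 2 := lt_of_lt_of_le hy0.2 (min_le_left _ _)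
  have hyl2 : y0 < ε2 - ε := lt_of_lt_of_le hy0.2 (min_le_right _ _)
  have hyl1 : y0 < 1 := by linarith [H.hδ1]
  set r := √(y0 / 2) with hrdef
  have hr : 0 < r := Real.sqrt_pos.mpr (by linarith)
  have hr2 : r ^ 2 = y0 / 2 := Real.sq_sqrt (by linarith)
  have hr1 : r ≤ 1 := by nlinarith
  have hr3 : r ^ 3 ≤ r ^ 2 := by nlinarith [sq_nonneg r]
  have pr3 : 0 < r ^ 3 := by positivity
  set x1 := x0 - r ^ 3 with hx1
  have hxin : ∀ t ∈ Icc (0:ℝ) 1, x1 + r ^ 3 * t ∈ Ioo ε X := by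
    intro t ht
    have q1 : 0 ≤ r ^ 3 * t := mul_nonneg pr3.le ht.1
    have q2 : r ^ 3 * t ≤ r ^ 3 := by nlinarith [ht.2]
    constructor
    · have := hx0.1; linarith
    · have := hx0.2; linarith
  have hyin : ∀ s ∈ Icc (1:ℝ) 3, r ^ 2 * s ∈ Ioo 0 δ' := by
    intro s hs
    have h1 := hs.1
    have h2 := hs.2
    rw [hr2]
    constructor
    · nlinarith
    · nlinarith
  have hin : ∀ t ∈ Icc (0:ℝ) 1, ∀ s ∈ Icc (1:ℝ) 3,
      (x1 + r ^ 3 * t, r ^ 2 * s) ∈ Ioo 0 X ×ˢ Ioo 0 δ := by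
    intro t ht s hs
    have h1 := hxin t ht
    have h2 := hyin s hs
    exact ⟨⟨by linarith [h1.1], h1.2⟩, ⟨h2.1, by linarith [h2.2]⟩⟩
  have hcont : ∀ (c : ℝ) (F : ℝ → ℝ → ℝ), Sm (Ioo 0 X ×ˢ Ioo 0 δ) F →
      ContinuousOn (fun z : ℝ × ℝ => c * F (x1 + r ^ 3 * z.1) (r ^ 2 * z.2))
        (Icc 0 1 ×ˢ Icc 1 3) := by
    intro c F hF
    apply ContinuousOn.const_mul
    exact hF.contOn.comp (f := fun z : ℝ × ℝ => (x1 + r ^ 3 * z.1, r ^ 2 * z.2))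
      (Continuous.continuousOn (by fun_prop)) (fun z hz => hin z.1 hz.1 z.2 hz.2)
  have s0 := H.smW k
  have s1 := H.smW (k+1)
  have key := hmain
    (fun t s => (r⁻¹) ^ 2 * WW w k (x1 + r ^ 3 * t) (r ^ 2 * s))
    (fun t s => r * WW w (k+1) (x1 + r ^ 3 * t) (r ^ 2 * s))
    (fun t s => r ^ 4 * WW w (k+2) (x1 + r ^ 3 * t) (r ^ 2 * s))
    (fun t s => r ^ 3 * Dy (WW w (k+1)) (x1 + r ^ 3 * t) (r ^ 2 * s))
    (fun t s => r ^ 5 * Dy (Dy (WW w (k+1))) (x1 + r ^ 3 * t) (r ^ 2 * s))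
    (fun t s => 1 * Dy (WW w k) (x1 + r ^ 3 * t) (r ^ 2 * s))
    (fun t s => r ^ 3 * Dy (WW w (k+1)) (x1 + r ^ 3 * t) (r ^ 2 * s))
    (fun t s => r ^ 2 * Dy (Dy (WW w k)) (x1 + r ^ 3 * t) (r ^ 2 * s))
    (fun t s => r ^ 4 * Dy (Dy (Dy (WW w k))) (x1 + r ^ 3 * t) (r ^ 2 * s))
    (fun t s => r⁻¹ * √(w (x1 + r ^ 3 * t) (r ^ 2 * s)))
    (fun t s => r * R (x1 + r ^ 3 * t) (r ^ 2 * s))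
    (hcont _ _ s0) (hcont _ _ s1) (hcont _ _ (s0.dy hU)) ?_
  · have ex : x1 + r ^ 3 * 1 = x0 := by rw [hx1]; ring
    have ey : r ^ 2 * 2 = y0 := by rw [hr2]; ring
    simp only [ex, ey, one_mul] at key
    refine ⟨key.2.trans (by linarith), ?_⟩
    have hsq : √y0 ≤ 2 * r := by
      rw [Real.sqrt_le_left (by positivity)]; nlinarith
    have h1 := key.1
    rw [abs_mul, abs_of_pos hr] at h1
    have := mul_le_mul_of_nonneg_left hsq (abs_nonneg (WW w (k+1) x0 y0))
    linarith
  · intro t ht s hs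
    have hz := hin t ht s hs
    have hx := hxin t ht
    have hy := hyin s hs
    have hys1 : r ^ 2 ≤ r ^ 2 * s := by nlinarith [hs.1, sq_nonneg r]
    have hys3 : r ^ 2 * s ≤ 3 * r ^ 2 := by nlinarith [hs.2, sq_nonneg r]
    obtain ⟨p1, p2, p3, p4, p5, p6⟩ :=
      pt_bounds H hk hε hδ' hC B hR hE hKR hAB hx hy hr hr1 hys1 hys3 hA
    have dW : ∀ j, HasDerivAt (fun x => WW w j x (r ^ 2 * s))
        (WW w (j+1) (x1 + r ^ 3 * t) (r ^ 2 * s)) (x1 + r ^ 3 * t) := by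
      intro j
      have := (H.smW j).hasDx hU hz
      rwa [Dx_WW] at this
    have dV : HasDerivAt (fun x => Dy (WW w k) x (r ^ 2 * s))
        (Dy (WW w (k+1)) (x1 + r ^ 3 * t) (r ^ 2 * s)) (x1 + r ^ 3 * t) := by
      have := (s0.dy hU).hasDx hU hz
      rwa [s0.comm hU hz, Dx_WW] at this
    refine ⟨scx (dW k) (by field_simp), scx (dW (k+1)) (by ring), scx dV (by ring),
      scy (s0.hasDy hU hz) (by field_simp), scy ((s0.dy hU).hasDy hU hz) (by ring),
      scy (((s0.dy hU).dy hU).hasDy hU hz) (by ring),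
      scy (s1.hasDy hU hz) (by ring), scy ((s1.dy hU).hasDy hU hz) (by ring),
      p1, p2, p3, p4, ?_, ?_, p6⟩
    · show r * WW w (k+1) _ _ = _
      rw [hE _ hz.1 _ hz.2]
      field_simp
    · simpa only [one_mul] using p5



lemma rpd (p : ℝ) {y : ℝ} (hy : 0 < y) : HasDerivAt (fun y : ℝ => y ^ p) (p * y ^ (p - 1)) y :=
  Real.hasDerivAt_rpow_const (Or.inl hy.ne')

lemma rp_small {p : ℝ} (hp : 0 < p) {e y : ℝ} (he : 0 < e) (hy : 0 < y) :
    ∃ ρ, 0 < ρ ∧ ρ < y ∧ ρ ^ p ≤ e := by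
  have h1 : Filter.Tendsto (fun ρ : ℝ => ρ ^ p) (nhdsWithin 0 (Ioi 0)) (nhds 0) := by
    have := (Real.continuousAt_rpow_const 0 p (Or.inr hp.le)).tendsto
    rw [Real.zero_rpow hp.ne'] at this
    exact this.mono_left nhdsWithin_le_nhds
  have h2 : ∀ᶠ ρ in nhdsWithin (0:ℝ) (Ioi 0), ρ ^ p < e := h1.eventually (gt_mem_nhds he)
  have h3 : ∀ᶠ ρ in nhdsWithin (0:ℝ) (Ioi 0), ρ ∈ Ioo 0 y := Ioo_mem_nhdsGT hy
  obtain ⟨ρ, a, b⟩ := (h2.and h3).exists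
  exact ⟨ρ, b.1, b.2, a.le⟩

set_option maxHeartbeats 1000000 in
lemma MP1 {c C0 C σ y2 : ℝ} (hc : 0 < c) (hC0 : 0 < C0) (hC : 0 < C) (hσ : 0 < σ) (hy2 : 0 < y2)
    (hy21 : y2 ≤ 1) : ∃ K : ℝ, 0 < K ∧ ∀ (x1 x2 : ℝ) (G Gx Gy Gyy a : ℝ → ℝ → ℝ),
    ContinuousOn (fun z : ℝ × ℝ => G z.1 z.2) (Icc x1 x2 ×ˢ Ioc 0 y2) →
    (∀ x ∈ Icc x1 x2, ∀ y ∈ Ioc 0 y2, HasDerivAt (fun s => G s y) (Gx x y) x ∧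
      HasDerivAt (fun t => G x t) (Gy x y) y ∧ HasDerivAt (fun t => Gy x t) (Gyy x y) y ∧
      c * √y ≤ a x y ∧ |G x y| ≤ C0 * y ^ (1 / 2 + σ) ∧
      |Gx x y - a x y * Gyy x y| ≤ C * y ^ (σ - 1 / 2)) →
    (∀ y ∈ Ioc 0 y2, G x1 y = 0) →
    ∀ x ∈ Icc x1 x2, ∀ y ∈ Ioo 0 y2, |G x y| ≤ K * y := by
  set K : ℝ := C / (c * σ) + C0 / y2 with hK
  have pK : 0 < K := by positivity
  refine ⟨2 * K, by positivity, ?_⟩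
  intro x1 x2 G Gx Gy Gyy a hG hpt h0 x hx y hy
  have main : ∀ e : ℝ, 0 < e → |G x y| ≤ K * (2 * y + e * y ^ (1 / 2 : ℝ)) := by
    intro e he
    obtain ⟨ρ, hρ0, hρy, hρe⟩ := rp_small hσ (e := K * e / C0) (by positivity) hy.1
    have sub : ∀ y ∈ Icc ρ y2, y ∈ Ioc 0 y2 := fun y hy => ⟨by linarith [hy.1], hy.2⟩
    have sub' : ∀ y ∈ Ioo ρ y2, y ∈ Ioc 0 y2 := fun y hy => ⟨by linarith [hy.1], hy.2.le⟩
    set b : ℝ → ℝ := fun y => 2 * y - y ^ (1 + σ) + e * y ^ (1 / 2 : ℝ) with hb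
    have hby : ∀ y ∈ Ioc 0 y2, y + e * y ^ (1 / 2 : ℝ) ≤ b y := by
      intro y hy
      have : y ^ (1 + σ) ≤ y := by
        have := Real.rpow_le_rpow_of_exponent_ge hy.1 (hy.2.trans hy21) (show 1 ≤ 1 + σ by linarith)
        simpa using this
      simp only [hb]; linarith
    have hbp : ∀ y ∈ Ioc 0 y2, 0 < b y := by
      intro y hy
      have h1 := hby y hy
      have h2 := hy.1
      have : 0 < y + e * y ^ (1 / 2 : ℝ) := by positivity
      linarith
    have hb1 : ∀ y ∈ Ioc 0 y2, HasDerivAt b (2 * 1 - (1 + σ) * y ^ (1 + σ - 1) +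
        e * (1 / 2 * y ^ ((1 / 2 : ℝ) - 1))) y := by
      intro y hy
      exact (((hasDerivAt_id y).const_mul 2).sub (rpd (1 + σ) hy.1)).add
        ((rpd (1 / 2) hy.1).const_mul e)
    have hb2 : ∀ y ∈ Ioc 0 y2, HasDerivAt (fun y => 2 * 1 - (1 + σ) * y ^ (1 + σ - 1) +
        e * (1 / 2 * y ^ ((1 / 2 : ℝ) - 1))) (- ((1 + σ) * ((1 + σ - 1) * y ^ (1 + σ - 1 - 1))) +
        e * (1 / 2 * (((1 / 2 : ℝ) - 1) * y ^ ((1 / 2 : ℝ) - 1 - 1)))) y := by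
      intro y hy
      exact (((rpd (1 + σ - 1) hy.1).const_mul (1 + σ)).const_sub (2 * 1)).add
        (((rpd ((1 / 2 : ℝ) - 1) hy.1).const_mul (1 / 2)).const_mul e)
    have := ratio_max (x1 := x1) (x2 := x2) (y1 := ρ) (y2 := y2) (K := K) (by linarith [hy.2])
      (G := G) (Gx := Gx) (Gy := Gy) (Gyy := Gyy) (a := a) (b := b)
      (hG.mono (fun z hz => ⟨hz.1, sub _ hz.2⟩))
      (fun y hy => (hb1 y (sub y hy)).continuousAt.continuousWithinAt)
      (fun y hy => hbp y (sub y hy))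
      (fun x hx y hy => (hpt x (Ioc_subset_Icc_self hx) y (sub' y hy)).1)
      (fun x hx y hy => (hpt x (Ioc_subset_Icc_self hx) y (sub' y hy)).2.1)
      (fun x hx y hy => (hpt x (Ioc_subset_Icc_self hx) y (sub' y hy)).2.2.1)
      (fun y hy => hb1 y (sub' y hy)) (fun y hy => hb2 y (sub' y hy))
      (fun x hx y hy => le_trans (by have := hy.1; positivity)
        (hpt x (Ioc_subset_Icc_self hx) y (sub' y hy)).2.2.2.1)
      (fun y hy => by
        rw [h0 y (sub y hy), abs_zero]
        exact (mul_pos pK (hbp y (sub y hy))).le)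
      (fun x hx => by
        have hr : ρ ∈ Ioc 0 y2 := ⟨hρ0, by linarith [hy.2]⟩
        refine (hpt x hx ρ hr).2.2.2.2.1.trans ?_
        have h1 : K * (e * ρ ^ (1 / 2 : ℝ)) ≤ K * b ρ := by
          apply mul_le_mul_of_nonneg_left _ pK.le
          linarith [hby ρ hr]
        refine le_trans ?_ h1
        rw [Real.rpow_add hρ0]
        have h2 : C0 * ρ ^ σ ≤ K * e := by
          rw [le_div_iff₀ hC0] at hρe; linarith
        have h3 := mul_le_mul_of_nonneg_right h2 (show 0 ≤ ρ ^ (1 / 2 : ℝ) by positivity)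
        linarith)
      (fun x hx => by
        have hr : y2 ∈ Ioc 0 y2 := ⟨hy2, le_rfl⟩
        refine (hpt x hx y2 hr).2.2.2.2.1.trans ?_
        have h1 : y2 ^ (1 / 2 + σ) ≤ 1 := Real.rpow_le_one hy2.le hy21 (by positivity)
        have h2 : C0 / y2 * y2 ≤ K * b y2 := by
          apply mul_le_mul _ _ hy2.le pK.le
          · rw [hK]; have : 0 ≤ C / (c * σ) := by positivity
            linarith
          · have := hby y2 hr
            have : 0 ≤ e * y2 ^ (1 / 2 : ℝ) := by positivity
            linarith
        have h3 : C0 / y2 * y2 = C0 := by field_simp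
        nlinarith)
      (fun x hx y hy L hL hGL => by
        obtain ⟨-, -, -, k1, -, k2⟩ := hpt x (Ioc_subset_Icc_self hx) y (sub' y hy)
        refine lt_of_le_of_lt k2 ?_
        have hy0 : 0 < y := by linarith [hy.1]
        have hLp : 0 < L := pK.trans hL
        have e1 : y ^ (σ - 1 / 2) = √y * y ^ (1 + σ - 1 - 1) := by
          rw [Real.sqrt_eq_rpow, ← Real.rpow_add hy0]; congr 1; ring
        rw [e1]
        have q0 : 0 < y ^ (1 + σ - 1 - 1) := Real.rpow_pos_of_pos hy0 _
        have q1 : 0 ≤ y ^ ((1:ℝ) / 2 - 1 - 1) := (Real.rpow_pos_of_pos hy0 _).le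
        have q2 : 0 < √y := Real.sqrt_pos.mpr hy0
        generalize y ^ (1 + σ - 1 - 1) = Y at *
        generalize y ^ ((1:ℝ) / 2 - 1 - 1) = Z at *
        have r1 : σ * Y ≤ -(-((1 + σ) * ((1 + σ - 1) * Y)) + e * (1 / 2 * ((1 / 2 - 1) * Z))) := by
          have : 0 ≤ e * Z := by positivity
          have : 0 ≤ σ * σ * Y := by positivity
          linarith
        have r2 : (c * √y) * (σ * Y) ≤ a x y * 
            -(-((1 + σ) * ((1 + σ - 1) * Y)) + e * (1 / 2 * ((1 / 2 - 1) * Z))) :=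
          mul_le_mul k1 r1 (by positivity) (le_trans (by positivity) k1)
        have r3 := mul_le_mul_of_nonneg_left r2 hLp.le
        have r4 : C < L * (c * σ) := by
          have : C / (c * σ) < L := by
            have : 0 < C0 / y2 := by positivity
            linarith
          rwa [div_lt_iff₀ (by positivity)] at this
        have r5 := mul_lt_mul_of_pos_right r4 (show 0 < √y * Y by positivity)
        linarith)
      x hx y ⟨hρy.le, hy.2.le⟩
    refine this.trans (mul_le_mul_of_nonneg_left ?_ pK.le)
    have : 0 ≤ y ^ (1 + σ) := Real.rpow_nonneg hy.1.le _
    simp only [hb]; linarith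
  have hlim : Filter.Tendsto (fun e : ℝ => K * (2 * y + e * y ^ (1 / 2 : ℝ)))
      (nhdsWithin 0 (Ioi 0)) (nhds (K * (2 * y + 0 * y ^ (1 / 2 : ℝ)))) := by
    apply Filter.Tendsto.mono_left _ nhdsWithin_le_nhds
    exact Continuous.tendsto (by fun_prop) 0
  have := ge_of_tendsto hlim (by
    filter_upwards [self_mem_nhdsWithin] with e he using main e he)
  linarith

set_option maxHeartbeats 1000000 in
lemma MP2 {c A A' y2 : ℝ} (hc : 0 < c) (hA : 0 < A) (hA' : 0 < A') (hy2 : 0 < y2)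
    (hy21 : y2 ≤ 1) (hsm : 16 * A * y2 ^ (1 / 4 : ℝ) ≤ c) :
    ∃ K : ℝ, 0 < K ∧ ∀ (x1 x2 Ch : ℝ) (G Gx Gy Gyy a : ℝ → ℝ → ℝ),
    ContinuousOn (fun z : ℝ × ℝ => G z.1 z.2) (Icc x1 x2 ×ˢ Ioc 0 y2) →
    (∀ x ∈ Icc x1 x2, ∀ y ∈ Ioc 0 y2, HasDerivAt (fun s => G s y) (Gx x y) x ∧
      HasDerivAt (fun t => G x t) (Gy x y) y ∧ HasDerivAt (fun t => Gy x t) (Gyy x y) y ∧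
      c * √y ≤ a x y ∧ |G x y| ≤ A' * (√y)⁻¹ ∧ |G x y| ≤ Ch * y ∧
      |Gx x y - a x y * Gyy x y| ≤ A * ((√y)⁻¹ + |G x y| / y)) →
    (∀ y ∈ Ioc 0 y2, G x1 y = 0) →
    ∀ x ∈ Icc x1 x2, ∀ y ∈ Ioo 0 y2, |G x y| ≤ K * y ^ (3 / 4 : ℝ) := by
  set K : ℝ := 1 + A' * (√y2)⁻¹ * (y2 ^ (3 / 4 : ℝ))⁻¹ with hK
  have hK1 : 1 ≤ K := by
    have : 0 ≤ A' * (√y2)⁻¹ * (y2 ^ (3 / 4 : ℝ))⁻¹ := by positivity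
    linarith
  have pK : 0 < K := by positivity
  refine ⟨K, pK, ?_⟩
  intro x1 x2 Ch G Gx Gy Gyy a hG hpt h0 x hx y hy
  obtain ⟨ρ, hρ0, hρy, hρe⟩ := rp_small (p := 1 / 4) (by norm_num) (e := (1 + |Ch|)⁻¹)
    (by positivity) hy.1
  have sub : ∀ y ∈ Icc ρ y2, y ∈ Ioc 0 y2 := fun y hy => ⟨by linarith [hy.1], hy.2⟩
  have sub' : ∀ y ∈ Ioo ρ y2, y ∈ Ioc 0 y2 := fun y hy => ⟨by linarith [hy.1], hy.2.le⟩
  have hb2 : ∀ y ∈ Ioc 0 y2, HasDerivAt (fun y : ℝ => (3 / 4 : ℝ) * y ^ ((3 / 4 : ℝ) - 1))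
      ((3 / 4 : ℝ) * (((3 / 4 : ℝ) - 1) * y ^ ((3 / 4 : ℝ) - 1 - 1))) y := fun y hy =>
    (rpd ((3 / 4 : ℝ) - 1) hy.1).const_mul _
  exact ratio_max (x1 := x1) (x2 := x2) (y1 := ρ) (y2 := y2) (K := K) (by linarith [hy.2])
      (G := G) (Gx := Gx) (Gy := Gy) (Gyy := Gyy) (a := a) (b := fun y => y ^ (3 / 4 : ℝ))
      (hG.mono (fun z hz => ⟨hz.1, sub _ hz.2⟩))
      (fun y hy => (rpd (3 / 4) (sub y hy).1).continuousAt.continuousWithinAt)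
      (fun y hy => Real.rpow_pos_of_pos (sub y hy).1 _)
      (fun x hx y hy => (hpt x (Ioc_subset_Icc_self hx) y (sub' y hy)).1)
      (fun x hx y hy => (hpt x (Ioc_subset_Icc_self hx) y (sub' y hy)).2.1)
      (fun x hx y hy => (hpt x (Ioc_subset_Icc_self hx) y (sub' y hy)).2.2.1)
      (fun y hy => rpd (3 / 4) (sub' y hy).1) (fun y hy => hb2 y (sub' y hy))
      (fun x hx y hy => le_trans (by have := hy.1; positivity)
        (hpt x (Ioc_subset_Icc_self hx) y (sub' y hy)).2.2.2.1)
      (fun y hy => by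
        rw [h0 y (sub y hy), abs_zero]
        exact (mul_pos pK (Real.rpow_pos_of_pos (sub y hy).1 _)).le)
      (fun x hx => by
        have hr : ρ ∈ Ioc 0 y2 := ⟨hρ0, by linarith [hy.2]⟩
        refine (hpt x hx ρ hr).2.2.2.2.2.1.trans ?_
        have e1 : ρ = ρ ^ (1 / 4 : ℝ) * ρ ^ (3 / 4 : ℝ) := by
          rw [← Real.rpow_add hρ0]; norm_num
        have h1 : Ch * ρ ^ (1 / 4 : ℝ) ≤ K := by
          have h2 : Ch * ρ ^ (1 / 4 : ℝ) ≤ (1 + |Ch|) * (1 + |Ch|)⁻¹ :=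
            mul_le_mul (by linarith [le_abs_self Ch]) hρe (by positivity) (by positivity)
          rw [mul_inv_cancel₀ (by positivity)] at h2
          linarith
        have h3 := mul_le_mul_of_nonneg_right h1 (show 0 ≤ ρ ^ (3 / 4 : ℝ) by positivity)
        calc Ch * ρ = Ch * ρ ^ (1 / 4 : ℝ) * ρ ^ (3 / 4 : ℝ) := by
              rw [mul_assoc, ← e1]
          _ ≤ _ := h3)
      (fun x hx => by
        have hr : y2 ∈ Ioc 0 y2 := ⟨hy2, le_rfl⟩
        refine (hpt x hx y2 hr).2.2.2.2.1.trans ?_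
        have q : 0 < y2 ^ (3 / 4 : ℝ) := by positivity
        have : A' * (√y2)⁻¹ * (y2 ^ (3 / 4 : ℝ))⁻¹ * y2 ^ (3 / 4 : ℝ) = A' * (√y2)⁻¹ := by
          field_simp
        show A' * (√y2)⁻¹ ≤ K * y2 ^ (3 / 4 : ℝ)
        rw [hK, add_mul]; linarith)
      (fun x hx y hy L hL hGL => by
        obtain ⟨-, -, -, k1, -, -, k2⟩ := hpt x (Ioc_subset_Icc_self hx) y (sub' y hy)
        refine lt_of_le_of_lt k2 ?_
        have hy0 : 0 < y := by linarith [hy.1]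
        have hy1 : y ≤ 1 := by linarith [hy.2]
        have hLp : 1 < L := by linarith
        rw [hGL]
        show A * ((√y)⁻¹ + L * y ^ (3 / 4 : ℝ) / y) < _
        set q := y ^ (1 / 4 : ℝ) with hq
        have pq : 0 < q := by positivity
        have hq2 : q ≤ y2 ^ (1 / 4 : ℝ) := Real.rpow_le_rpow hy0.le hy.2.le (by norm_num)
        have hq1 : q ≤ 1 := Real.rpow_le_one hy0.le hy1 (by norm_num)
        have e4 : y = q ^ 4 := by
          rw [hq, ← Real.rpow_natCast, ← Real.rpow_mul hy0.le]; norm_num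
        have e2 : √y = q ^ 2 := by
          rw [hq, ← Real.rpow_natCast, ← Real.rpow_mul hy0.le, Real.sqrt_eq_rpow]; norm_num
        have e3 : y ^ (3 / 4 : ℝ) = q ^ 3 := by
          rw [hq, ← Real.rpow_natCast, ← Real.rpow_mul hy0.le]; norm_num
        have e5 : y ^ ((3 / 4 : ℝ) - 1 - 1) = (q ^ 5)⁻¹ := by
          rw [hq, ← Real.rpow_natCast, ← Real.rpow_mul hy0.le, ← Real.rpow_neg hy0.le]; norm_num
        rw [e5, e2, e3]
        rw [e2] at k1
        have e6 : L * q ^ 3 / y = L * q⁻¹ := by rw [e4]; field_simp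
        rw [e6]
        have r1 : c * q ^ 2 * (3 / 16 * (q ^ 5)⁻¹) ≤ a x y * (3 / 16 * (q ^ 5)⁻¹) :=
          mul_le_mul_of_nonneg_right k1 (by positivity)
        have e7 : c * q ^ 2 * (3 / 16 * (q ^ 5)⁻¹) = 3 / 16 * c * (q⁻¹) ^ 3 := by field_simp
        rw [e7] at r1
        have r2 := mul_le_mul_of_nonneg_left r1 (show 0 ≤ L by linarith)
        have e8 : (q ^ 2)⁻¹ = q * (q⁻¹) ^ 3 := by field_simp
        have e9 : q⁻¹ = q ^ 2 * (q⁻¹) ^ 3 := by field_simp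
        have p3 : 0 < (q⁻¹) ^ 3 := by positivity
        rw [e8]; nth_rewrite 2 [e9]
        have r3 : A * (q + L * q ^ 2) ≤ L * (c / 8) := by
          have z1 : q + L * q ^ 2 ≤ 2 * L * q := by
            have a1 : q ≤ L * q := le_mul_of_one_le_left pq.le hLp.le
            have a2 : q ^ 2 ≤ q := by rw [pow_two]; exact mul_le_of_le_one_left pq.le hq1
            have a3 := mul_le_mul_of_nonneg_left a2 (show 0 ≤ L by linarith)
            linarith
          have z2 : A * (q + L * q ^ 2) ≤ A * (2 * L * q) := mul_le_mul_of_nonneg_left z1 hA.le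
          have z3 : 16 * A * q ≤ c := le_trans (by gcongr) hsm
          have z4 := mul_le_mul_of_nonneg_left z3 (show 0 ≤ L by linarith)
          linarith
        have r4 : L * (c / 8) < L * (3 / 16 * c) :=
          mul_lt_mul_of_pos_left (by linarith) (by linarith)
        have r5 := mul_lt_mul_of_pos_right (lt_of_le_of_lt r3 r4) p3
        linarith)
      x hx y ⟨hρy.le, hy.2.le⟩



lemma Ctx.sq_lb {X δ m M : ℝ} {w : ℝ → ℝ → ℝ} {g : ℝ → ℝ} (H : Ctx X δ m M w g) {x y : ℝ}
    (hx : x ∈ Ioo 0 X) (hy : y ∈ Ioo 0 δ) : √m * √y ≤ √(w x y) := by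
  rw [← Real.sqrt_mul H.hm.le]
  exact Real.sqrt_le_sqrt (H.lb x hx y hy).le

lemma Ctx.dW {X δ m M : ℝ} {w : ℝ → ℝ → ℝ} {g : ℝ → ℝ} (H : Ctx X δ m M w g) (j : ℕ) {x y : ℝ}
    (hx : x ∈ Ioo 0 X) (hy : y ∈ Ioo 0 δ) :
    HasDerivAt (fun s => WW w j s y) (WW w (j+1) x y) x := by
  have := (H.smW j).hasDx (isOpenU X δ) (x := x) (y := y) ⟨hx, hy⟩
  rwa [Dx_WW] at this

lemma Ctx.mv {X δ m M : ℝ} {w : ℝ → ℝ → ℝ} {g : ℝ → ℝ} (H : Ctx X δ m M w g) (j : ℕ) {e y D : ℝ}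
    (he : 0 ≤ e) (hy : y ∈ Ioo 0 δ) (hD : ∀ x ∈ Ioo e X, |WW w (j+1) x y| ≤ D) {x x' : ℝ}
    (hx : x ∈ Ioo e X) (hx' : x' ∈ Ioo e X) :
    |WW w j x y - WW w j x' y| ≤ D * |x - x'| := by
  have hmv := Convex.norm_image_sub_le_of_norm_hasDerivWithin_le (𝕜 := ℝ)
        (f := fun s => WW w j s y) (f' := fun s => WW w (j+1) s y) (C := D) (s := Ioo e X)
        (x := x') (y := x) (fun s hs => (H.dW j ⟨by linarith [hs.1], hs.2⟩ hy).hasDerivWithinAt)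
        (fun s hs => hD s hs) (convex_Ioo _ _) hx' hx
  simpa only [Real.norm_eq_abs] using hmv

set_option maxHeartbeats 1000000 in
lemma mp1_apply {X δ m M : ℝ} {w : ℝ → ℝ → ℝ} {g : ℝ → ℝ} (H : Ctx X δ m M w g) (j : ℕ)
    {σ C0 C1 e e' d : ℝ} (hσ : 0 < σ) (hC0 : 0 < C0) (hC1 : 0 < C1) (he : 0 ≤ e) (hee : e < e')
    (hd0 : 0 < d) (hd : d ≤ δ)
    (h1 : ∀ x ∈ Ioo e X, ∀ y ∈ Ioo 0 d, |WW w j x y| ≤ C0 * y ^ (1 / 2 + σ))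
    (h2 : ∀ x ∈ Ioo e X, ∀ y ∈ Ioo 0 d,
      |WW w (j+1) x y - √(w x y) * Dy (Dy (WW w j)) x y| ≤ C1 * y ^ (σ - 1 / 2)) :
    ∃ K : ℝ, 0 < K ∧ ∀ x ∈ Ioo e' X, ∀ y ∈ Ioo 0 (d / 2), |WW w j x y| ≤ K * y := by
  have hU := isOpenU X δ
  have hX := H.hX
  have hm := H.hm
  have hδ1 := H.hδ1
  set x1 := (e + e') / 2 with hx1
  have hx1e : e < x1 := by rw [hx1]; linarith
  have hx1e' : x1 < e' := by rw [hx1]; linarith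
  obtain ⟨K, pK, hK⟩ := MP1 (c := √m) (C0 := X * C0) (C := C0 + X * C1) (σ := σ) (y2 := d / 2)
    (Real.sqrt_pos.mpr hm) (by positivity) (by positivity) hσ (by linarith) (by linarith)
  refine ⟨K / (e' - x1), div_pos pK (by linarith), ?_⟩
  intro x hx y hy
  have hin : ∀ s ∈ Icc x1 x, s ∈ Ioo e X := fun s hs => ⟨by linarith [hs.1], by linarith [hs.2, hx.2]⟩
  have hin0 : ∀ s ∈ Icc x1 x, s ∈ Ioo 0 X := fun s hs => ⟨by linarith [(hin s hs).1], (hin s hs).2⟩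
  have hyn : ∀ t ∈ Ioc 0 (d / 2), t ∈ Ioo 0 d := fun t ht => ⟨ht.1, by linarith [ht.2]⟩
  have hyn0 : ∀ t ∈ Ioc 0 (d / 2), t ∈ Ioo 0 δ := fun t ht => ⟨ht.1, by linarith [ht.2]⟩
  have key := hK x1 x (fun s t => (s - x1) * WW w j s t)
    (fun s t => 1 * WW w j s t + (s - x1) * WW w (j+1) s t)
    (fun s t => (s - x1) * Dy (WW w j) s t) (fun s t => (s - x1) * Dy (Dy (WW w j)) s t)
    (fun s t => √(w s t)) ?_ ?_ ?_ x ⟨by linarith [hx.1], le_rfl⟩ y hy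
  · have hp : 0 < x - x1 := by linarith [hx.1]
    beta_reduce at key
    rw [abs_mul, abs_of_pos hp] at key
    have hq : 0 < e' - x1 := by linarith
    rw [div_mul_eq_mul_div, le_div_iff₀ hq]
    have : |WW w j x y| * (e' - x1) ≤ |WW w j x y| * (x - x1) :=
      mul_le_mul_of_nonneg_left (by linarith [hx.1]) (abs_nonneg _)
    linarith
  · refine ContinuousOn.mul (Continuous.continuousOn (by fun_prop)) ?_
    exact (H.smW j).contOn.mono (fun z hz => ⟨hin0 _ hz.1, hyn0 _ hz.2⟩)
  · intro s hs t ht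
    have hz : (s, t) ∈ Ioo 0 X ×ˢ Ioo 0 δ := ⟨hin0 s hs, hyn0 t ht⟩
    have ht0 := ht.1
    have ht1 : t ≤ 1 := by linarith [ht.2]
    have b1 := h1 s (hin s hs) t (hyn t ht)
    have b2 := h2 s (hin s hs) t (hyn t ht)
    have p0 : 0 ≤ s - x1 := by linarith [hs.1]
    have pX : s - x1 ≤ X := by linarith [hs.2, hx.2]
    refine ⟨(((hasDerivAt_id s).sub_const x1).mul (H.dW j hz.1 hz.2)),
      ((H.smW j).hasDy hU hz).const_mul _, (((H.smW j).dy hU).hasDy hU hz).const_mul _,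
      H.sq_lb hz.1 hz.2, ?_, ?_⟩
    · rw [abs_mul, abs_of_nonneg p0]
      have := mul_le_mul pX b1 (abs_nonneg _) hX.le
      linarith
    · have e : 1 * WW w j s t + (s - x1) * WW w (j+1) s t -
          √(w s t) * ((s - x1) * Dy (Dy (WW w j)) s t) =
        WW w j s t + (s - x1) * (WW w (j+1) s t - √(w s t) * Dy (Dy (WW w j)) s t) := by ring
      show |1 * WW w j s t + (s - x1) * WW w (j+1) s t -
          √(w s t) * ((s - x1) * Dy (Dy (WW w j)) s t)| ≤ _
      rw [e]
      refine (abs_add_le _ _).trans ?_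
      rw [abs_mul, abs_of_nonneg p0]
      have r1 := mul_le_mul pX b2 (abs_nonneg _) hX.le
      have r2 : t ^ (1 / 2 + σ) ≤ t ^ (σ - 1 / 2) :=
        Real.rpow_le_rpow_of_exponent_ge ht0 ht1 (by linarith)
      have r3 := mul_le_mul_of_nonneg_left r2 hC0.le
      linarith
  · intro t ht
    simp

set_option maxHeartbeats 2000000 in
lemma step2 {X δ m M : ℝ} {w : ℝ → ℝ → ℝ} {g : ℝ → ℝ} (H : Ctx X δ m M w g) {k : ℕ}
    (hk : 1 ≤ k) {ε δ' C K1 : ℝ} (hε : 0 ≤ ε) (hδ0 : 0 < δ') (hδ' : δ' ≤ δ)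
    (hC : 0 ≤ C) (B : Bd X w k ε δ' C) (hK1 : 0 < K1)
    (hI : ∀ x ∈ Ioo ε X, ∀ y ∈ Ioo 0 δ', |WW w (k+1) x y| * √y ≤ K1) {ε' : ℝ} (hεε : ε < ε') :
    ∃ K d : ℝ, 0 < K ∧ 0 < d ∧ d ≤ δ' ∧ ∀ x ∈ Ioo ε' X, ∀ y ∈ Ioo 0 d,
      |WW w (k+1) x y| ≤ K * y ^ (3 / 4 : ℝ) := by
  obtain ⟨R, hR, hE⟩ := eqnk H k
  obtain ⟨KR, hKR, hAB⟩ := AlgB H hk hε hδ' hC B hR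
  have hU := isOpenU X δ
  have hX := H.hX
  have hm := H.hm
  have hδ1 := H.hδ1
  have hsm : 0 < √m := Real.sqrt_pos.mpr hm
  set x1 := (ε + ε') / 2 with hx1
  have hx1e : ε < x1 := by rw [hx1]; linarith
  have hx1e' : x1 < ε' := by rw [hx1]; linarith
  obtain ⟨A, hA⟩ : ∃ A, A = K1 + X * (C * (K1 + KR) / m + KR) + KR := ⟨_, rfl⟩
  have pA : 0 < A := by rw [hA]; positivity
  obtain ⟨d, hd0, hdδ, hds⟩ := rp_small (p := 1 / 4) (by norm_num) (e := √m / (16 * A))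
    (by positivity) hδ0
  rw [le_div_iff₀ (by positivity)] at hds
  obtain ⟨K, pK, hK⟩ := MP2 (c := √m) (A := A) (A' := X * K1) (y2 := d)
    hsm pA (by positivity) hd0 (by linarith) (by linarith)
  refine ⟨K / (ε' - x1), d, div_pos pK (by linarith), hd0, hdδ.le, ?_⟩
  intro x hx y hy
  have hyin : ∀ t ∈ Ioc 0 d, t ∈ Ioo 0 δ' := fun t ht => ⟨ht.1, by linarith [ht.2]⟩
  have hyin0 : ∀ t ∈ Ioc 0 d, t ∈ Ioo 0 δ := fun t ht => ⟨ht.1, by linarith [ht.2]⟩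
  have main : ∀ h, 0 < h → h < x1 - ε →
      (x - x1) * |(WW w k x y - WW w k (x - h) y) / h| ≤ K * y ^ (3 / 4 : ℝ) := by
    intro h hh hhε
    have hin : ∀ s ∈ Icc x1 x, s ∈ Ioo ε X :=
      fun s hs => ⟨by linarith [hs.1], by linarith [hs.2, hx.2]⟩
    have hin0 : ∀ s ∈ Icc x1 x, s ∈ Ioo 0 X :=
      fun s hs => ⟨by linarith [(hin s hs).1], (hin s hs).2⟩
    have hin' : ∀ s ∈ Icc x1 x, s - h ∈ Ioo ε X :=
      fun s hs => ⟨by linarith [hs.1], by linarith [hs.2, hx.2]⟩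
    have hin0' : ∀ s ∈ Icc x1 x, s - h ∈ Ioo 0 X :=
      fun s hs => ⟨by linarith [(hin' s hs).1], (hin' s hs).2⟩
    have key := hK x1 x (X * (2 * C) / h)
      (fun s t => (s - x1) * ((WW w k s t - WW w k (s - h) t) / h))
      (fun s t => 1 * ((WW w k s t - WW w k (s - h) t) / h) +
        (s - x1) * ((WW w (k+1) s t - WW w (k+1) (s - h) t) / h))
      (fun s t => (s - x1) * ((Dy (WW w k) s t - Dy (WW w k) (s - h) t) / h))
      (fun s t => (s - x1) * ((Dy (Dy (WW w k)) s t - Dy (Dy (WW w k)) (s - h) t) / h))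
      (fun s t => √(w s t)) ?_ ?_ ?_ x ⟨by linarith [hx.1], le_rfl⟩ y hy
    · have hp : 0 < x - x1 := by linarith [hx.1]
      beta_reduce at key
      rwa [abs_mul, abs_of_pos hp] at key
    · refine ContinuousOn.mul (Continuous.continuousOn (by fun_prop)) (ContinuousOn.div_const ?_ _)
      refine ContinuousOn.sub 
        ((H.smW k).contOn.mono (fun z hz => ⟨hin0 _ hz.1, hyin0 _ hz.2⟩)) ?_
      exact (H.smW k).contOn.comp (f := fun z : ℝ × ℝ => (z.1 - h, z.2))
        (Continuous.continuousOn (by fun_prop)) (fun z hz => ⟨hin0' _ hz.1, hyin0 _ hz.2⟩)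
    · intro s hs t ht
      have hz : (s, t) ∈ Ioo 0 X ×ˢ Ioo 0 δ := ⟨hin0 s hs, hyin0 t ht⟩
      have hz' : (s - h, t) ∈ Ioo 0 X ×ˢ Ioo 0 δ := ⟨hin0' s hs, hyin0 t ht⟩
      have ht0 := ht.1
      have ht1 : t ≤ 1 := by linarith [ht.2]
      have st : 0 < √t := Real.sqrt_pos.mpr ht0
      have stt : √t * √t = t := Real.mul_self_sqrt ht0.le
      have st1 : √t ≤ 1 := Real.sqrt_le_one.mpr ht1
      have p0 : 0 ≤ s - x1 := by linarith [hs.1]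
      have pX : s - x1 ≤ X := by linarith [hs.2, hx.2]
      have hF1 : |(WW w k s t - WW w k (s - h) t) / h| ≤ K1 * (√t)⁻¹ := by
        rw [abs_div, abs_of_pos hh, div_le_iff₀ hh]
        have := H.mv k hε hz.2 (D := K1 * (√t)⁻¹) (fun x hx => by
          rw [← div_eq_mul_inv, le_div_iff₀ st]
          exact hI x hx t (hyin t ht)) (hin s hs) (hin' s hs)
        simpa [abs_of_pos hh] using this
      set F := (WW w k s t - WW w k (s - h) t) / h with hF
      refine ⟨?_, ?_, ?_, H.sq_lb hz.1 hz.2, ?_, ?_, ?_⟩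
      · have d1 := H.dW k hz.1 hz.2
        have d2 := (H.dW k hz'.1 hz'.2).comp s ((hasDerivAt_id s).sub_const h)
        rw [mul_one] at d2
        exact ((hasDerivAt_id s).sub_const x1).mul ((d1.sub d2).div_const h)
      · exact ((((H.smW k).hasDy hU hz).sub ((H.smW k).hasDy hU hz')).div_const h).const_mul _
      · exact (((((H.smW k).dy hU).hasDy hU hz).sub
          (((H.smW k).dy hU).hasDy hU hz')).div_const h).const_mul _
      · rw [abs_mul, abs_of_nonneg p0]
        have := mul_le_mul pX hF1 (abs_nonneg _) hX.le
        linarith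
      · rw [abs_mul, abs_of_nonneg p0]
        have q1 := B.b1 s (hin s hs) t (hyin t ht) k hk le_rfl
        have q2 := B.b1 _ (hin' s hs) t (hyin t ht) k hk le_rfl
        have q3 : |F| ≤ 2 * C * t / h := by
          rw [hF, abs_div, abs_of_pos hh]
          apply div_le_div_of_nonneg_right _ hh.le
          exact (abs_sub _ _).trans (by linarith)
        have := mul_le_mul pX q3 (abs_nonneg _) hX.le
        refine this.trans (le_of_eq ?_)
        ring
      · show |1 * F + (s - x1) * ((WW w (k+1) s t - WW w (k+1) (s - h) t) / h) -
          √(w s t) * ((s - x1) * ((Dy (Dy (WW w k)) s t - Dy (Dy (WW w k)) (s - h) t) / h))| ≤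
          A * ((√t)⁻¹ + |(s - x1) * F| / t)
        have e0 : 1 * F + (s - x1) * ((WW w (k+1) s t - WW w (k+1) (s - h) t) / h) -
          √(w s t) * ((s - x1) * ((Dy (Dy (WW w k)) s t - Dy (Dy (WW w k)) (s - h) t) / h)) =
          F + (s - x1) * ((√(w s t) - √(w (s - h) t)) / h * Dy (Dy (WW w k)) (s - h) t +
            (R s t - R (s - h) t) / h) := by
          rw [hE s hz.1 t hz.2, hE _ hz'.1 t hz'.2]
          ring
        rw [e0]
        have a0 := H.sq_lb hz.1 hz.2
        have a1 := H.sq_lb hz'.1 hz'.2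
        have w0 := H.wpos hz.1 hz.2
        have w1 := H.wpos hz'.1 hz'.2
        have pmt : 0 < √m * √t := by positivity
        have u1 : |(√(w s t) - √(w (s - h) t)) / h| ≤ C * √t / √m := by
          rw [abs_div, abs_of_pos hh, div_le_iff₀ hh]
          have v1 := H.mv 0 hε hz.2 (D := C * t)
            (fun x hx => B.b1 x hx t (hyin t ht) 1 le_rfl hk) (hin s hs) (hin' s hs)
          rw [WW_zero] at v1
          have v2 : w s t - w (s - h) t =
              (√(w s t) - √(w (s - h) t)) * (√(w s t) + √(w (s - h) t)) := by
            have v3 : √(w s t) * √(w s t) = w s t := Real.mul_self_sqrt w0.le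
            have v4 : √(w (s - h) t) * √(w (s - h) t) = w (s - h) t := Real.mul_self_sqrt w1.le
            linear_combination - v3 + v4
          have v5 : |s - (s - h)| = h := by rw [sub_sub_cancel, abs_of_pos hh]
          rw [v2, v5, abs_mul, abs_of_pos (show 0 < √(w s t) + √(w (s - h) t) by linarith)] at v1
          have v6 : |√(w s t) - √(w (s - h) t)| * (√m * √t) ≤ C * t * h :=
            le_trans (mul_le_mul_of_nonneg_left (by linarith) (abs_nonneg _)) v1
          rw [← le_div_iff₀ pmt] at v6
          refine v6.trans (le_of_eq ?_)
          rw [div_mul_eq_mul_div, div_eq_div_iff pmt.ne' hsm.ne']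
          linear_combination (-(C * h * √m)) * stt
        have u2 : |Dy (Dy (WW w k)) (s - h) t| ≤ (K1 + KR) / (√m * t) := by
          have v1 : √(w (s - h) t) * Dy (Dy (WW w k)) (s - h) t =
            WW w (k+1) (s - h) t - R (s - h) t := by
            rw [hE _ hz'.1 t hz'.2]; ring
          have v2 : √(w (s - h) t) * |Dy (Dy (WW w k)) (s - h) t| ≤
              |WW w (k+1) (s - h) t| + KR := by
            rw [← abs_of_pos (show 0 < √(w (s - h) t) by linarith), ← abs_mul, v1]
            refine (abs_sub _ _).trans ?_
            have := (hAB _ (hin' s hs) _ (hin' s hs) t (hyin t ht)).1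
            linarith
          have v3 := hI _ (hin' s hs) t (hyin t ht)
          rw [le_div_iff₀ (by positivity)]
          have v4 : (√m * √t) * |Dy (Dy (WW w k)) (s - h) t| ≤
              |WW w (k+1) (s - h) t| + KR :=
            le_trans (mul_le_mul_of_nonneg_right a1 (abs_nonneg _)) v2
          have v5 := mul_le_mul_of_nonneg_right v4 st.le
          have v6 : KR * √t ≤ KR := mul_le_of_le_one_right hKR st1
          have v7 : |Dy (Dy (WW w k)) (s - h) t| * (√m * t) =
            √m * √t * |Dy (Dy (WW w k)) (s - h) t| * √t := by
            linear_combination (-(|Dy (Dy (WW w k)) (s - h) t| * √m)) * stt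
          rw [v7]
          linarith
        have u3 : |(R s t - R (s - h) t) / h| ≤ KR * (1 + |F| / t) := by
          have := (hAB s (hin s hs) _ (hin' s hs) t (hyin t ht)).2.2
          rw [sub_sub_cancel, abs_of_pos hh] at this
          rw [abs_div, abs_of_pos hh, div_le_iff₀ hh]
          refine this.trans (le_of_eq ?_)
          rw [hF, abs_div, abs_of_pos hh]
          field_simp
        have u4 : |(√(w s t) - √(w (s - h) t)) / h * Dy (Dy (WW w k)) (s - h) t| ≤
            C * (K1 + KR) / m * (√t)⁻¹ := by
          rw [abs_mul]
          refine (mul_le_mul u1 u2 (abs_nonneg _) (by positivity)).trans (le_of_eq ?_)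
          have hmm : √m * √m = m := Real.mul_self_sqrt hm.le
          rw [div_mul_div_comm, ← div_eq_mul_inv, div_div,
            div_eq_div_iff (by positivity) (by positivity)]
          linear_combination C * (K1 + KR) * (m * stt - t * hmm)
        have u5 : 1 ≤ (√t)⁻¹ := (one_le_inv₀ st).mpr st1
        refine (abs_add_le _ _).trans ?_
        rw [abs_mul, abs_mul, abs_of_nonneg p0]
        have u6 := (abs_add_le ((√(w s t) - √(w (s - h) t)) / h * Dy (Dy (WW w k)) (s - h) t)
          ((R s t - R (s - h) t) / h)).trans (add_le_add u4 u3)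
        have u7 := mul_le_mul_of_nonneg_left u6 p0
        set Q := (√t)⁻¹ with hQ
        have pD : 0 ≤ C * (K1 + KR) / m := by positivity
        set D := C * (K1 + KR) / m with hD
        have pF : 0 ≤ |F| / t := by positivity
        have u8 : (s - x1) * (D * Q + KR) ≤ X * (D * Q + KR) :=
          mul_le_mul_of_nonneg_right pX (by positivity)
        have u9 : KR ≤ KR * Q := le_mul_of_one_le_right hKR u5
        have u9' := mul_le_mul_of_nonneg_left u9 hX.le
        have u10 : (s - x1) * |F| / t = (s - x1) * (|F| / t) := by ring
        rw [u10]
        have u11 : KR * ((s - x1) * (|F| / t)) ≤ A * ((s - x1) * (|F| / t)) := by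
          apply mul_le_mul_of_nonneg_right _ (by positivity)
          rw [hA]
          have : 0 ≤ X * (D + KR) := by positivity
          linarith
        have u12 : (K1 + X * (D + KR)) * Q ≤ A * Q := by
          apply mul_le_mul_of_nonneg_right _ (by positivity)
          rw [hA]; linarith
        linarith
    · intro t ht
      simp
  -- pass to the limit
  have hxε : x ∈ Ioo 0 X := ⟨by linarith [hx.1], hx.2⟩
  have hd := H.dW k hxε (hyin0 y ⟨hy.1, hy.2.le⟩)
  have hneg : Filter.Tendsto (fun h : ℝ => x - h) (nhdsWithin 0 (Ioi 0)) (nhdsWithin x {x}ᶜ) := by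
    apply tendsto_nhdsWithin_of_tendsto_nhds_of_eventually_within
    · have : Filter.Tendsto (fun h : ℝ => x - h) (nhds 0) (nhds (x - 0)) :=
        Continuous.tendsto (by fun_prop) 0
      rw [sub_zero] at this
      exact this.mono_left nhdsWithin_le_nhds
    · filter_upwards [self_mem_nhdsWithin] with h hh
      have : 0 < h := hh
      simp only [mem_compl_iff, mem_singleton_iff]
      linarith
  have ht := (((hd.tendsto_slope.comp hneg).abs).const_mul (x - x1))
  have hfin : (x - x1) * |WW w (k+1) x y| ≤ K * y ^ (3 / 4 : ℝ) := by
    refine le_of_tendsto ht ?_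
    filter_upwards [Ioo_mem_nhdsGT (show 0 < x1 - ε by linarith)] with h hh
    refine le_trans (le_of_eq ?_) (main h hh.1 hh.2)
    have hh0 : h ≠ 0 := hh.1.ne'
    congr 2
    simp only [Function.comp, slope, vsub_eq_sub, smul_eq_mul]
    have : x - h - x = -h := by ring
    rw [this]
    field_simp
    ring
  rw [div_mul_eq_mul_div, le_div_iff₀ (by linarith)]
  have : |WW w (k+1) x y| * (ε' - x1) ≤ |WW w (k+1) x y| * (x - x1) :=
    mul_le_mul_of_nonneg_left (by linarith [hx.1]) (abs_nonneg _)
  linarith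



def HH (X δ : ℝ) (w : ℝ → ℝ → ℝ) (k : ℕ) : Prop :=
  ∀ ε ∈ Ioo 0 X, ∃ d C : ℝ, 0 < d ∧ d ≤ δ ∧ 0 < C ∧ Bd X w k ε d C

set_option maxHeartbeats 1000000 in
lemma HH_base {X δ m M : ℝ} {w : ℝ → ℝ → ℝ} {g : ℝ → ℝ} (H : Ctx X δ m M w g)
    {C0 α : ℝ} (hC0 : 0 < C0) (hα : 0 < α) (hα2 : α < 1 / 2)
    (h1 : ∀ x ∈ Ioo 0 X, ∀ y ∈ Ioo 0 δ, |WW w 1 x y| ≤ C0 * y ^ (1 / 2 + α)) :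
    HH X δ w 1 := by
  intro ε hε
  have hm := H.hm
  have hM : 0 < M := hm.trans H.hmM
  have hX := H.hX
  have hc : ∀ i, Continuous (iteratedDeriv i g) := fun i =>
      (continuous_iff_continuousAt.mpr fun x => (hasDeriv_src H.hg i x).continuousAt)
  obtain ⟨A1, hA1⟩ := isCompact_Icc.exists_bound_of_continuousOn
      (s := Icc 0 X) (hc 0).continuousOn
  obtain ⟨A2, hA2⟩ := isCompact_Icc.exists_bound_of_continuousOn
      (s := Icc 0 X) (hc 1).continuousOn
  have h0 : (0:ℝ) ∈ Icc 0 X := ⟨le_rfl, H.hX.le⟩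
  have p1 : 0 ≤ A1 := (norm_nonneg _).trans (hA1 0 h0)
  have p2 : 0 ≤ A2 := (norm_nonneg _).trans (hA2 0 h0)
  simp only [iteratedDeriv_zero, Real.norm_eq_abs] at hA1 hA2
  obtain ⟨K, pK, hK⟩ := mp1_apply H 1 (σ := α) (C0 := C0) (C1 := A2 + C0 / m * (C0 + A1))
    (e := 0) (e' := ε) (d := δ) hα hC0 (by positivity) le_rfl hε.1 H.hδ0 le_rfl h1 (by
      intro x hx y hy
      have hy0 := hy.1
      have hy1 : y ≤ 1 := by linarith [hy.2, H.hδ1]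
      have hE : ∀ x ∈ Ioo 0 X, ∀ y ∈ Ioo 0 δ,
        WW w (0+1) x y = √(w x y) * Dy (Dy (WW w 0)) x y + g x := by
        rw [WW_zero]; exact H.eqn
      have hR : HasDerivAt (fun s => g s) (iteratedDeriv 1 g x) x := by
        have := hasDeriv_src H.hg 0 x
        simpa using this
      have e := eqn_next H (k := 0) (R := fun x _ => g x) hE hx hy hR
      simp only [zero_add] at e
      have hxc : x ∈ Icc 0 X := ⟨hx.1.le, hx.2.le⟩
      rw [show (1 + 1 : ℕ) = 2 from rfl, e, add_sub_cancel_left]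
      have b1 := h1 x hx y hy
      have hw := H.wpos hx hy
      have q1 : |WW w 1 x y / w x y| ≤ C0 / m * y ^ (α - 1 / 2) := by
        rw [abs_div, abs_of_pos hw, div_le_iff₀ hw]
        have e1 : y ^ (1 / 2 + α) = y ^ (α - 1 / 2) * y := by
          rw [← Real.rpow_add_one hy0.ne']; congr 1; ring
        rw [e1] at b1
        have lw := H.lb x hx y hy
        have pz : 0 ≤ y ^ (α - 1 / 2) := by positivity
        have z := mul_le_mul_of_nonneg_left lw.le
          (show 0 ≤ C0 / m * y ^ (α - 1 / 2) by positivity)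
        refine b1.trans (le_trans (le_of_eq ?_) z)
        field_simp
      have hY : 1 ≤ y ^ (α - 1 / 2) := Real.one_le_rpow_of_pos_of_le_one_of_nonpos hy0 hy1
        (by linarith)
      have q2 : |WW w 1 x y - g x| ≤ C0 + A1 := by
        refine (abs_sub _ _).trans (add_le_add ?_ (hA1 x hxc))
        refine b1.trans (mul_le_of_le_one_right hC0.le ?_)
        exact Real.rpow_le_one hy0.le hy1 (by linarith)
      generalize y ^ (α - 1 / 2) = Y at *
      refine (abs_add_le _ _).trans ?_
      rw [abs_mul, abs_mul, abs_of_pos (show (0:ℝ) < 1 / 2 by norm_num)]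
      have q3 := mul_le_mul q1 q2 (abs_nonneg _) (by positivity)
      have q4 : 0 ≤ |WW w 1 x y / w x y| * |WW w 1 x y - g x| := by positivity
      have q5 := hA2 x hxc
      have q6 : A2 ≤ A2 * Y := le_mul_of_one_le_right p2 hY
      linarith)
  refine ⟨δ / 2, K + M, by linarith [H.hδ0], by linarith [H.hδ0], by positivity, ?_, ?_⟩
  · intro x hx y hy j hj1 hj2
    obtain rfl : j = 1 := le_antisymm hj2 hj1
    have := hK x hx y hy
    have : 0 ≤ M * y := mul_nonneg hM.le hy.1.le
    linarith
  · intro x hx y hy j hj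
    obtain rfl : j = 0 := by omega
    rw [WW_zero]
    have := H.slope x ⟨by linarith [hx.1, hε.1], hx.2⟩ y ⟨hy.1, by linarith [hy.2, H.hδ0]⟩
    linarith

lemma Bd.mono {X : ℝ} {w : ℝ → ℝ → ℝ} {k : ℕ} {ε δ C ε' δ' C' : ℝ} (h : Bd X w k ε δ C)
    (h1 : ε ≤ ε') (h2 : δ' ≤ δ) (h3 : C ≤ C') : Bd X w k ε' δ' C' := by
  refine ⟨fun x hx y hy j a b => ?_, fun x hx y hy j a => ?_⟩
  · have := h.b1 x ⟨by linarith [hx.1], hx.2⟩ y ⟨hy.1, by linarith [hy.2]⟩ j a b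
    exact this.trans (mul_le_mul_of_nonneg_right h3 hy.1.le)
  · have := h.b2 x ⟨by linarith [hx.1], hx.2⟩ y ⟨hy.1, by linarith [hy.2]⟩ j a
    linarith

set_option maxHeartbeats 1000000 in
lemma HH_step {X δ m M : ℝ} {w : ℝ → ℝ → ℝ} {g : ℝ → ℝ} (H : Ctx X δ m M w g) {k : ℕ}
    (hk : 1 ≤ k) (h : HH X δ w k) : HH X δ w (k+1) := by
  intro ε hε
  have hm := H.hm
  have hε0 := hε.1
  obtain ⟨d, C, hd0, hdδ, hC, B⟩ := h (ε / 2) ⟨by linarith, by linarith [hε.2]⟩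
  obtain ⟨K1, d1, hK1, hd10, hd1, hI⟩ := interior_est H hk (ε2 := ε * (5 / 8)) (by linarith)
    (by linarith) hd0 hdδ hC.le B
  have B1 : Bd X w k (ε * (5 / 8)) d1 C := B.mono (by linarith) hd1 le_rfl
  obtain ⟨K2, d2, hK2, hd20, hd2, hS⟩ := step2 H hk (by linarith) hd10 (hd1.trans hdδ) hC.le B1 hK1
    (fun x hx y hy => (hI x hx y hy).2) (ε' := ε * (6 / 8)) (by linarith)
  have B2 : Bd X w k (ε * (6 / 8)) d2 C := B1.mono (by linarith) hd2 le_rfl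
  obtain ⟨R, hR, hE⟩ := eqnk H k
  obtain ⟨KR, hKR, hAB⟩ := AlgB H hk (by linarith) (hd2.trans (hd1.trans hdδ)) hC.le B2 hR
  obtain ⟨R', -, hd⟩ := hR.dx H
  obtain ⟨K, pK, hK⟩ := mp1_apply H (k+1) (σ := 1 / 4) (C0 := K2)
    (C1 := KR * (1 + K2) + C / m * (K2 + KR) )
    (e := ε * (6 / 8)) (e' := ε) (d := d2) (by norm_num) hK2 (by positivity) (by linarith)
    (by linarith) hd20 (hd2.trans (hd1.trans hdδ))
    (fun x hx y hy => by
      have := hS x hx y hy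
      norm_num at this ⊢
      exact this)
    (by
      intro x hx y hy
      have hxX : x ∈ Ioo 0 X := ⟨by linarith [hx.1], hx.2⟩
      have hyδ : y ∈ Ioo 0 δ := ⟨hy.1, by linarith [hy.2]⟩
      have hy0 := hy.1
      have hy1 : y ≤ 1 := by linarith [hyδ.2, H.hδ1]
      have hd := hd x hxX y hyδ
      rw [show k + 1 + 1 = k + 2 from rfl, eqn_next H hE hxX hyδ hd, add_sub_cancel_left]
      have hR' := AB_dx hAB hx hy hd (H.dW k hxX hyδ)
      have hs := hS x hx y hy
      have hw := H.wpos hxX hyδ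
      have lw := H.lb x hxX y hyδ
      have hY : 1 ≤ y ^ ((1:ℝ) / 4 - 1 / 2) :=
        Real.one_le_rpow_of_pos_of_le_one_of_nonpos hy0 hy1 (by norm_num)
      have hs1 : |WW w (k+1) x y| / y ≤ K2 * y ^ ((1:ℝ) / 4 - 1 / 2) := by
        rw [div_le_iff₀ hy0]
        refine hs.trans (le_of_eq ?_)
        rw [mul_assoc, ← Real.rpow_add_one hy0.ne']
        norm_num
      have hs2 : |WW w (k+1) x y| ≤ K2 :=
        hs.trans (mul_le_of_le_one_right hK2.le (Real.rpow_le_one hy0.le hy1 (by norm_num)))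
      generalize y ^ ((1:ℝ) / 4 - 1 / 2) = Y at *
      have q2 : |WW w 1 x y / w x y| ≤ C / m := by
        rw [abs_div, abs_of_pos hw, div_le_div_iff₀ hw hm]
        have := B2.b1 x hx y hy 1 le_rfl hk
        have z1 := mul_le_mul_of_nonneg_right this hm.le
        have z2 := mul_le_mul_of_nonneg_left lw.le hC.le
        linarith
      have q3 : |WW w (k+1) x y - R x y| ≤ K2 + KR :=
        (abs_sub _ _).trans (add_le_add hs2 (hAB x hx x hx y hy).1)
      refine (abs_add_le _ _).trans ?_
      rw [abs_mul, abs_mul, abs_of_pos (show (0:ℝ) < 1 / 2 by norm_num)]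
      have q4 := mul_le_mul q2 q3 (abs_nonneg _) (by positivity)
      have q5 : 0 ≤ |WW w 1 x y / w x y| * |WW w (k+1) x y - R x y| := by positivity
      have q6 : C / m * (K2 + KR) ≤ C / m * (K2 + KR) * Y :=
        le_mul_of_one_le_right (by positivity) hY
      have q7 : KR * (1 + |WW w (k+1) x y| / y) ≤ KR * (Y + K2 * Y) :=
        mul_le_mul_of_nonneg_left (by linarith) hKR
      linarith)
  refine ⟨d2 / 2, C + K + K1, by linarith, by linarith, by positivity, ?_, ?_⟩
  · intro x hx y hy j hj1 hj2
    have hy0 := hy.1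
    rcases Nat.lt_or_ge k j with hj | hj
    · obtain rfl : j = k + 1 := by omega
      have := hK x hx y hy
      have : 0 ≤ (C + K1) * y := by positivity
      linarith
    · have := B2.b1 x ⟨by linarith [hx.1], hx.2⟩ y ⟨hy0, by linarith [hy.2]⟩ j hj1 hj
      have : 0 ≤ (K + K1) * y := by positivity
      linarith
  · intro x hx y hy j hj
    have hy0 := hy.1
    rcases Nat.lt_or_ge j k with hj' | hj'
    · have := B2.b2 x ⟨by linarith [hx.1], hx.2⟩ y ⟨hy0, by linarith [hy.2]⟩ j hj'
      linarith
    · obtain rfl : j = k := by omega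
      have := (hI x ⟨by linarith [hx.1], hx.2⟩ y ⟨hy0, by linarith [hy.2]⟩).1
      linarith

lemma endpt {X δ : ℝ} {V : ℝ → ℝ → ℝ} (hV : Sm (Ioo 0 X ×ˢ Ioo 0 δ) V) {k : ℕ} (hk : 1 ≤ k)
    {e y C : ℝ} (he : 0 ≤ e) (heX : e < X) (hC : 0 ≤ C) (hy : y ∈ Ioo 0 δ)
    (hb : ∀ x ∈ Ioo e X, |WW V k x y| ≤ C) : |WW V k X y| ≤ C := by
  obtain ⟨n, rfl⟩ : ∃ n, k = n + 1 := ⟨k - 1, by omega⟩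
  have hdx : ∀ x ∈ Ioo e X, HasDerivAt (fun s => WW V n s y) (WW V (n+1) x y) x := by
    intro x hx
    have := (hV.WW (isOpenU X δ) n).hasDx (isOpenU X δ) (x := x) (y := y)
      ⟨⟨by linarith [hx.1], hx.2⟩, hy⟩
    rwa [Dx_WW] at this
  have hX : WW V (n+1) X y = deriv (fun s => WW V n s y) X := by
    rw [← Dx_WW]; rfl
  by_cases hd : DifferentiableAt ℝ (fun s => WW V n s y) X
  · rw [hX]
    have hD := hd.hasDerivAt.tendsto_slope.abs
    have hD2 := hD.mono_left (nhdsWithin_mono X (fun s (hs : s ∈ Iio X) => ne_of_lt hs))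
    refine le_of_tendsto hD2 ?_
    filter_upwards [Ioo_mem_nhdsLT heX] with s hs
    have hmv := norm_image_sub_le_of_norm_deriv_le_segment' (a := s) (b := X) (C := C)
      (f := fun s => WW V n s y) (f' := fun x => WW V (n+1) x y)
      (fun x hx => by
        rcases hx.2.eq_or_lt with h | h
        · simp only [h, hX]
          exact hd.hasDerivAt.hasDerivWithinAt
        · exact (hdx x ⟨by linarith [hx.1, hs.1], h⟩).hasDerivWithinAt)
      (fun x hx => hb x ⟨by linarith [hx.1, hs.1], hx.2⟩) X ⟨hs.2.le, le_rfl⟩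
    rw [Real.norm_eq_abs] at hmv
    simp only [slope, vsub_eq_sub, smul_eq_mul]
    have hp : 0 < X - s := by linarith [hs.2]
    rw [abs_mul, abs_inv, abs_sub_comm s X, abs_of_pos hp, inv_mul_le_iff₀ hp,
      abs_sub_comm]
    linarith
  · rw [hX, deriv_zero_of_not_differentiableAt hd, abs_zero]
    exact hC


lemma pd0 (w : ℝ → ℝ → ℝ) (k : ℕ) : pd k 0 w = WW w k := by
  funext x y
  simp only [pd, WW, iteratedDeriv_zero]

lemma pd1 (w : ℝ → ℝ → ℝ) (k : ℕ) : pd k 1 w = WW (Dy w) k := by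
  funext x y
  simp only [pd, WW, Dy, iteratedDeriv_one]

lemma pd2 (w : ℝ → ℝ → ℝ) (k : ℕ) : pd k 2 w = WW (Dy (Dy w)) k := by
  funext x y
  simp only [pd, WW, Dy, iteratedDeriv_succ, iteratedDeriv_zero]

lemma ctx_of {X : ℝ} {p : ℝ → ℝ} {w : ℝ → ℝ → ℝ} {α m M C₀ δ₁ : ℝ}
    (hw : OleinikSolution X p w α m M C₀ δ₁) :
    Ctx X δ₁ m M w (fun x => -2 * deriv p x) where
  hX := hw.hX
  hδ0 := hw.hδ₁.1
  hδ1 := hw.hδ₁.2.le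
  hm := hw.hm
  hmM := hw.hmM
  sm := hw.smooth.mono (fun z hz => ⟨⟨hz.1.1, hz.1.2.le⟩, hz.2.1⟩)
  hg := contDiff_const.mul (contDiff_infty_iff_deriv.1 hw.hp).2
  eqn := fun x hx y hy => by
    have := hw.eqn x ⟨hx.1, hx.2.le⟩ y hy.1
    rw [pd0, pd2, WW_zero] at this
    linarith
  lb := fun x hx y hy => hw.growth_lb x ⟨hx.1.le, hx.2.le⟩ y ⟨hy.1, hy.2.le⟩
  ub := fun x hx y hy => hw.growth_ub x ⟨hx.1.le, hx.2.le⟩ y ⟨hy.1, hy.2.le⟩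
  slope := fun x hx y hy => by
    have h1 := hw.slope_lb x ⟨hx.1.le, hx.2.le⟩ y ⟨hy.1.le, hy.2.le⟩
    have h2 := hw.slope_ub x ⟨hx.1.le, hx.2.le⟩ y ⟨hy.1.le, hy.2.le⟩
    rw [pd1, WW_zero] at h1 h2
    have := hw.hm
    have := hw.hmM
    exact abs_le.2 ⟨by linarith, h2.le⟩

lemma HH_all {X : ℝ} {p : ℝ → ℝ} {w : ℝ → ℝ → ℝ} {α m M C₀ δ₁ : ℝ}
    (hw : OleinikSolution X p w α m M C₀ δ₁) (k : ℕ) (hk : 1 ≤ k) : HH X δ₁ w k := by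
  induction k, hk using Nat.le_induction with
  | base =>
    refine HH_base (ctx_of hw) hw.hC₀ hw.hα.1 hw.hα.2 ?_
    intro x hx y hy
    have := hw.dx_bound x ⟨hx.1.le, hx.2.le⟩ y ⟨hy.1.le, hy.2.le⟩
    rwa [pd0] at this
  | succ k hk ih => exact HH_step (ctx_of hw) hk ih

/-- Higher order regularity estimates: for any `0 < ε < X` and any integer `k ≥ 2`
there exist `δ > 0` and `C > 0` such that on `[ε,X] × (0,δ]` one has
`|∂ₓ^k w| ≤ C ψ`, `|∂_ψ ∂ₓ^k w| ≤ C` and `|∂_ψ² ∂ₓ^k w| ≤ C ψ^{-1}`. -/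
theorem higher_order_estimates (X : ℝ) (p : ℝ → ℝ) (w : ℝ → ℝ → ℝ) (α m M C₀ δ₁ : ℝ)
    (hw : OleinikSolution X p w α m M C₀ δ₁)
    (ε : ℝ) (hε : 0 < ε) (hεX : ε < X) (k : ℕ) (hk : 2 ≤ k) :
    ∃ δ > 0, ∃ C > 0,
      ∀ x ∈ Set.Icc ε X, ∀ ψ ∈ Set.Ioc (0 : ℝ) δ,
        |pd k 0 w x ψ| ≤ C * ψ ∧
        |pd k 1 w x ψ| ≤ C ∧
        |pd k 2 w x ψ| ≤ C * ψ⁻¹ := by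
  have H := ctx_of hw
  obtain ⟨d, C, hd, hdδ, hC, B⟩ := HH_all hw (k+1) (by omega) (ε/2) ⟨by linarith, by linarith⟩
  obtain ⟨R, hR, hE⟩ := eqnk H k
  obtain ⟨K, hK, hAB⟩ := AlgB H (by omega : 1 ≤ k+1) (by linarith : 0 ≤ ε/2) hdδ hC.le B hR.succ
  have hsm : 0 < √m := Real.sqrt_pos.2 hw.hm
  have hQ : 0 ≤ (C + K) / √m := by positivity
  have hU := isOpenU X δ₁
  have e1 : ∀ x y, (x, y) ∈ Ioo 0 X ×ˢ Ioo 0 δ₁ → WW (Dy w) k x y = Dy (WW w k) x y :=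
    fun x y h => WW_Dy hU H.sm k x y h
  have e2 : ∀ x y, (x, y) ∈ Ioo 0 X ×ˢ Ioo 0 δ₁ →
      WW (Dy (Dy w)) k x y = Dy (Dy (WW w k)) x y := fun x y h => by
    rw [WW_Dy hU (H.sm.dy hU) k x y h]
    exact Dy_congr hU e1 h
  have main : ∀ x ∈ Ioo (ε/2) X, ∀ y ∈ Ioo 0 d, |WW w k x y| ≤ (C + (C + K) / √m) * y ∧
      |WW (Dy w) k x y| ≤ C + (C + K) / √m ∧
      |WW (Dy (Dy w)) k x y| ≤ (C + (C + K) / √m) * y⁻¹ := by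
    intro x hx y hy
    have hxX : x ∈ Ioo 0 X := ⟨by linarith [hx.1], hx.2⟩
    have hyδ : y ∈ Ioo 0 δ₁ := ⟨hy.1, by linarith [hy.2]⟩
    have hy0 := hy.1
    have hy1 : y ≤ 1 := by linarith [hyδ.2, H.hδ1]
    refine ⟨?_, ?_, ?_⟩
    · have := B.b1 x hx y hy k (by omega) (by omega)
      have : 0 ≤ (C + K) / √m * y := by positivity
      linarith
    · rw [e1 x y ⟨hxX, hyδ⟩]
      have := B.b2 x hx y hy k (by omega)
      linarith
    · rw [e2 x y ⟨hxX, hyδ⟩]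
      have h1 := B.b1 x hx y hy (k+1) (by omega) le_rfl
      have h2 := (hAB x hx x hx y hy).1
      have h3 := hE x hxX y hyδ
      have hl : √m * y ≤ √(w x y) := by
        apply Real.le_sqrt_of_sq_le
        rw [mul_pow, Real.sq_sqrt hw.hm.le]
        have h4 := H.lb x hxX y hyδ
        have h5 : m * y ^ 2 ≤ m * y := mul_le_mul_of_nonneg_left (by nlinarith) hw.hm.le
        linarith
      have h6 : √(w x y) * |Dy (Dy (WW w k)) x y| ≤ C + K := by
        rw [← abs_of_nonneg (Real.sqrt_nonneg (w x y)), ← abs_mul,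
          show √(w x y) * Dy (Dy (WW w k)) x y = WW w (k+1) x y - R x y by linarith]
        have h7 := abs_sub (WW w (k+1) x y) (R x y)
        have h8 : C * y ≤ C := by nlinarith
        linarith
      have h9 : √m * y * |Dy (Dy (WW w k)) x y| ≤ C + K :=
        (mul_le_mul_of_nonneg_right hl (abs_nonneg _)).trans h6
      have h10 : |Dy (Dy (WW w k)) x y| ≤ (C + K) / √m * y⁻¹ := by
        rw [← div_eq_mul_inv, div_div, le_div_iff₀ (by positivity)]
        linarith
      have : 0 ≤ C * y⁻¹ := by positivity
      linarith
  refine ⟨d / 2, by linarith, C + (C + K) / √m, by linarith, ?_⟩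
  intro x hx y hy
  rw [pd0, pd1, pd2]
  have hyd : y ∈ Ioo 0 d := ⟨hy.1, by linarith [hy.2]⟩
  have hyδ : y ∈ Ioo 0 δ₁ := ⟨hy.1, by linarith [hyd.2]⟩
  have hy0 := hy.1
  rcases hx.2.eq_or_lt with h | h
  · subst h
    have he : 0 ≤ ε / 2 := by linarith
    have heX : ε / 2 < x := by linarith
    have hk1 : 1 ≤ k := by omega
    exact ⟨endpt H.sm hk1 he heX (by positivity) hyδ (fun s hs => (main s hs y hyd).1),
      endpt (H.sm.dy hU) hk1 he heX (by positivity) hyδ (fun s hs => (main s hs y hyd).2.1),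
      endpt ((H.sm.dy hU).dy hU) hk1 he heX (by positivity) hyδ
        (fun s hs => (main s hs y hyd).2.2)⟩
  · exact main x ⟨by linarith [hx.1], h⟩ y hyd
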